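/- arXiv:1105.2051 — 3 statements merged into one kernel-verified Lean document; each statement's English description precedes it below -/
import Mathlib

section
/- If k is a field such that the Brauer group of every proper regular integral curve over k vanishes (a B1 field), then for every finite field extension L of k, the Brauer group Br(L) is trivial. -/
universe u

open TensorProduct

/-- `A` is a finite-dimensional central simple algebra over the field `F`. -/
def IsCSA (F A : Type u) [Field F] [Ring A] [Algebra F A] : Prop :=
  FiniteDimensional F A ∧ Algebra.IsCentral F A ∧ IsSimpleRing A

/-- `A` is split over `F`, i.e. isomorphic to a matrix algebra over `F`
(its Brauer class is trivial). -/
def IsMatrixAlgebra (F A : Type u) [Field F] [Ring A] [Algebra F A] : Prop :=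
  ∃ n : ℕ, 0 < n ∧ Nonempty (A ≃ₐ[F] Matrix (Fin n) (Fin n) F)

/-- The Brauer group of the field `F` is trivial: every finite-dimensional central
simple `F`-algebra is a matrix algebra. -/
def BrauerTrivial (F : Type u) [Field F] : Prop :=
  ∀ (A : Type u) [Ring A] [Algebra F A], IsCSA F A → IsMatrixAlgebra F A

/-- `A` and `B` have the same Brauer class over `F`. -/
def BrauerEquiv (F A B : Type u) [Field F] [Ring A] [Algebra F A] [Ring B] [Algebra F B] :
    Prop :=
  ∃ n m : ℕ, 0 < n ∧ 0 < m ∧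
    Nonempty (Matrix (Fin n) (Fin n) A ≃ₐ[F] Matrix (Fin m) (Fin m) B)

/-- `A₀` is an Azumaya algebra over the local ring `O`: it is a finite free `O`-algebra
whose reduction modulo the maximal ideal is a central simple algebra over the residue
field. -/
def IsAzumayaOver (O A₀ : Type u) [CommRing O] [IsLocalRing O] [Ring A₀] [Algebra O A₀] :
    Prop :=
  Module.Free O A₀ ∧ Module.Finite O A₀ ∧
    IsCSA (IsLocalRing.ResidueField O) ((IsLocalRing.ResidueField O) ⊗[O] A₀)

/-- A central simple algebra `D` over `F` is unramified at a valuation subring `O` of `F`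
if it extends to an Azumaya algebra over `O`. -/
def UnramifiedAt (F : Type u) [Field F] (O : ValuationSubring F) (D : Type u) [Ring D]
    [Algebra F D] : Prop :=
  ∃ (A₀ : Type u) (_ : Ring A₀) (_ : Algebra O A₀),
    IsAzumayaOver O A₀ ∧ Nonempty ((F ⊗[↥O] A₀) ≃ₐ[F] D)

/-- `F` is the function field of a proper regular integral (not necessarily geometrically
integral) curve over `k`: a finitely generated field extension of `k` of transcendence
degree 1. -/
def IsCurveFunctionField (k F : Type u) [Field k] [Field F] [Algebra k F] : Prop :=
  (∃ s : Finset F, IntermediateField.adjoin k (s : Set F) = ⊤) ∧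
  (∃ x : F, Transcendental k x ∧
    Algebra.IsAlgebraic (IntermediateField.adjoin k ({x} : Set F)) F)

/-- `k` has property B₁: for every proper regular integral curve `C` over `k`, the
cohomological Brauer group `Br(C)` vanishes.  Since for a regular proper curve `C/k`
one has `Br(C) = ⋂ₓ Br(O_{C,x}) ⊆ Br(k(C))` — the subgroup of classes of the function
field `k(C)` unramified at every valuation of `k(C)` trivial on `k` — this is expressed
as: every central simple algebra over such a function field which is unramified at every
`k`-valuation subring is split. -/
def IsB1 (k : Type u) [Field k] : Prop :=
  ∀ (F : Type u) [Field F] [Algebra k F], IsCurveFunctionField k F →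
    ∀ (D : Type u) [Ring D] [Algebra F D], IsCSA F D →
      (∀ O : ValuationSubring F, (∀ c : k, algebraMap k F c ∈ O) → UnramifiedAt F O D) →
      IsMatrixAlgebra F D

/-!
STATEMENT 0: If `k` is a field such that the Brauer group of every proper regular
integral curve over `k` vanishes (a B₁ field), then for every finite field extension
`L` of `k`, the Brauer group `Br(L)` is trivial.
-/


namespace BT

section density
variable {L A : Type u} [Field L] [Ring A] [Algebra L A]

/-- multiplication algebra -/
abbrev MA (L A : Type u) [Field L] [Ring A] [Algebra L A] : Subalgebra L (Module.End L A) :=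
  (AlgHom.mulLeftRight L A).range

lemma mulL_mem (a : A) : LinearMap.mulLeft L a ∈ MA L A :=
  ⟨a ⊗ₜ 1, by ext x; simp [AlgHom.mulLeftRight_apply]⟩

lemma mulR_mem (a : A) : LinearMap.mulRight L a ∈ MA L A :=
  ⟨1 ⊗ₜ MulOpposite.op a, by ext x; simp [AlgHom.mulLeftRight_apply]⟩

lemma exists_one [IsSimpleRing A] {x : A} (hx : x ≠ 0) : ∃ T ∈ MA L A, T x = 1 := by
  let I : TwoSidedIdeal A := TwoSidedIdeal.mk' {y | ∃ T ∈ MA L A, T x = y}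
    ⟨0, zero_mem _, by simp⟩
    (by rintro _ _ ⟨T, hT, rfl⟩ ⟨S, hS, rfl⟩; exact ⟨T + S, add_mem hT hS, rfl⟩)
    (by rintro _ ⟨T, hT, rfl⟩; exact ⟨-T, neg_mem hT, rfl⟩)
    (by rintro a _ ⟨T, hT, rfl⟩; exact ⟨_ * T, mul_mem (mulL_mem a) hT, rfl⟩)
    (by rintro _ a ⟨T, hT, rfl⟩; exact ⟨_ * T, mul_mem (mulR_mem a) hT, rfl⟩)
  have hmem : ∀ y, y ∈ I ↔ ∃ T ∈ MA L A, T x = y := fun y => TwoSidedIdeal.mem_mk' ..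
  have hI : I = ⊤ := by
    rcases eq_bot_or_eq_top I with h | h
    · exfalso
      have : x ∈ I := (hmem x).2 ⟨1, one_mem _, rfl⟩
      rw [h] at this
      exact hx ((TwoSidedIdeal.mem_bot A).1 this)
    · exact h
  have : (1 : A) ∈ I := by rw [hI]; trivial
  exact (hmem 1).1 this

lemma density [IsSimpleRing A] [Algebra.IsCentral L A] (W : Submodule L A) (hW : W.FG) :
    ∀ v : A, v ∉ W → ∃ T ∈ MA L A, (∀ w ∈ W, T w = 0) ∧ T v = 1 := by
  suffices ∀ v : A, v ∉ W → ∃ T ∈ MA L A, (∀ w ∈ W, T w = 0) ∧ T v ≠ 0 by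
    intro v hv
    obtain ⟨T, hT, h0, h1⟩ := this v hv
    obtain ⟨S, hS, h⟩ := exists_one (L := L) h1
    exact ⟨S * T, mul_mem hS hT, fun w hw => by simp [h0 w hw], h⟩
  obtain ⟨s, rfl⟩ := hW
  classical
  induction s using Finset.induction with
  | empty =>
    intro v hv
    refine ⟨1, one_mem _, by simp, ?_⟩
    rintro h
    apply hv
    rw [show v = 0 from h]
    exact zero_mem _
  | insert w s hws ih =>
    intro v hv
    by_cases hw : w ∈ Submodule.span L (s : Set A)
    · have : Submodule.span L ((insert w s : Finset A) : Set A) = Submodule.span L (s : Set A) := by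
        rw [Finset.coe_insert, Submodule.span_insert_eq_span hw]
      rw [this] at hv ⊢
      exact ih v hv
    · obtain ⟨T1, hT1, hT1s, hT1w⟩ := ih w hw
      obtain ⟨S, hS, hS1⟩ := exists_one (L := L) hT1w
      obtain ⟨T0, hT0, hT0s, hT0w⟩ : ∃ T ∈ MA L A,
          (∀ w ∈ Submodule.span L (s : Set A), T w = 0) ∧ T w = 1 :=
        ⟨S * T1, mul_mem hS hT1, fun w hw => by simp [hT1s w hw], hS1⟩
      by_contra! hcon
      have key : ∀ T ∈ MA L A, (∀ x ∈ Submodule.span L (s : Set A), T x = 0) → T w = 0 →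
          T v = 0 := by
        intro T hT hTs hTw
        apply hcon T hT
        intro x hx
        rw [Finset.coe_insert, Submodule.mem_span_insert] at hx
        obtain ⟨a, z, hz, rfl⟩ := hx
        simp [hTw, hTs z hz]
      have hc : T0 v ∈ Subalgebra.center L A := by
        rw [Subalgebra.mem_center_iff]
        intro a
        have := key (LinearMap.mulLeft L a * T0 - LinearMap.mulRight L a * T0)
          (sub_mem (mul_mem (mulL_mem a) hT0) (mul_mem (mulR_mem a) hT0))
          (fun x hx => by simp [hT0s x hx]) (by simp [hT0w])
        simpa [sub_eq_zero] using this
      rw [Algebra.IsCentral.center_eq_bot, Algebra.mem_bot] at hc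
      obtain ⟨c, hc⟩ := hc
      have h2 : v - c • w ∈ Submodule.span L (s : Set A) := by
        by_contra hn
        obtain ⟨T, hT, hTs, hTn⟩ := ih _ hn
        apply hTn
        have := key (T - LinearMap.mulLeft L (T w) * T0)
          (sub_mem hT (mul_mem (mulL_mem _) hT0))
          (fun x hx => by simp [hT0s x hx, hTs x hx]) (by simp [hT0w])
        simp only [LinearMap.sub_apply, Module.End.mul_apply, LinearMap.mulLeft_apply, ← hc] at this
        rw [map_sub, map_smul, Algebra.smul_def, Algebra.commutes, this]
      apply hv
      rw [Finset.coe_insert, Submodule.mem_span_insert]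
      exact ⟨c, _, h2, by abel⟩

lemma exists_coord [IsSimpleRing A] [Algebra.IsCentral L A] {ι : Type u} [Finite ι]
    (b : Module.Basis ι L A) (i : ι) :
    ∃ T ∈ MA L A, ∀ a, T a = algebraMap L A (b.repr a i) := by
  obtain ⟨T, hT, h0, h1⟩ := density (Submodule.span L (b '' {i}ᶜ))
    (Submodule.fg_span ((Set.toFinite _).image _)) (b i)
    (b.linearIndependent.notMem_span_image (by simp))
  refine ⟨T, hT, fun a => ?_⟩
  have : T = (Algebra.linearMap L A) ∘ₗ (b.coord i) := by
    apply b.ext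
    intro j
    by_cases hj : j = i
    · subst hj; simp [h1]
    · rw [h0 _ (Submodule.subset_span ⟨j, hj, rfl⟩)]
      simp [hj]
  rw [this]; rfl

variable {K : Type u} [Field K] [Algebra L K]

lemma lT_pure (a : A) (c : Aᵐᵒᵖ) (x : K ⊗[L] A) :
    (AlgHom.mulLeftRight L A (a ⊗ₜ c)).lTensor K x = (1 ⊗ₜ a) * x * (1 ⊗ₜ c.unop) := by
  induction x with
  | zero => simp
  | tmul y z => simp [AlgHom.mulLeftRight_apply]
  | add x y hx hy => rw [map_add, hx, hy, mul_add, add_mul]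

lemma lT_mem (I : TwoSidedIdeal (K ⊗[L] A)) {x : K ⊗[L] A} (hx : x ∈ I)
    {T : Module.End L A} (hT : T ∈ MA L A) : T.lTensor K x ∈ I := by
  obtain ⟨t, rfl⟩ := hT
  induction t with
  | zero => simp [I.zero_mem]
  | tmul a c =>
    refine (lT_pure a c x) ▸ ?_
    exact I.mul_mem_right _ _ (I.mul_mem_left _ _ hx)
  | add s t hs ht =>
    have := I.add_mem hs ht
    simpa [LinearMap.lTensor_add] using this

lemma lT_center {z : K ⊗[L] A} (hz : ∀ y, y * z = z * y)
    {T : Module.End L A} (hT : T ∈ MA L A) : T.lTensor K z = z * (1 ⊗ₜ T 1) := by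
  obtain ⟨t, rfl⟩ := hT
  induction t with
  | zero => simp
  | tmul a c =>
    refine (lT_pure a c z).trans ?_
    rw [hz, mul_assoc]
    simp [AlgHom.mulLeftRight_apply]
  | add s t hs ht =>
    simp only [RingHom.coe_coe, AlgHom.toRingHom_eq_coe] at hs ht ⊢
    rw [map_add, LinearMap.lTensor_add, LinearMap.add_apply, hs, ht, LinearMap.add_apply,
      TensorProduct.tmul_add, mul_add]

lemma lT_coord {ι : Type u} (b : Module.Basis ι L A) (i : ι) (T : Module.End L A)
    (hT : ∀ a, T a = algebraMap L A (b.repr a i)) (x : K ⊗[L] A) :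
    T.lTensor K x = ((b.baseChange K).repr x i) ⊗ₜ 1 := by
  induction x with
  | zero => simp
  | tmul y z =>
    simp [hT, Algebra.algebraMap_eq_smul_one, TensorProduct.smul_tmul']
  | add x y hx hy => rw [map_add, hx, hy, map_add, Finsupp.add_apply, TensorProduct.add_tmul]

lemma simple_bc [FiniteDimensional L A] [IsSimpleRing A] [Algebra.IsCentral L A] :
    IsSimpleRing (K ⊗[L] A) := by
  have : Nontrivial (K ⊗[L] A) := by
    apply Module.nontrivial_of_finrank_pos (R := K)
    rw [Module.finrank_baseChange]; exact Module.finrank_pos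
  refine ⟨⟨fun I => ?_⟩⟩
  by_cases h : ∃ x ∈ I, x ≠ 0
  · right
    obtain ⟨x, hx, hx0⟩ := h
    let b := Module.Free.chooseBasis L A
    obtain ⟨i, hi⟩ : ∃ i, (b.baseChange K).repr x i ≠ 0 := by
      by_contra! h
      exact hx0 ((b.baseChange K).repr.map_eq_zero_iff.1 (Finsupp.ext h))
    obtain ⟨T, hT, hTa⟩ := exists_coord b i
    have h1 := lT_mem I hx hT
    rw [lT_coord b i T hTa] at h1
    have h2 := I.mul_mem_left (((b.baseChange K).repr x i)⁻¹ ⊗ₜ 1) _ h1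
    rw [Algebra.TensorProduct.tmul_mul_tmul, inv_mul_cancel₀ hi, mul_one,
      ← Algebra.TensorProduct.one_def] at h2
    exact (TwoSidedIdeal.one_mem_iff I).1 h2
  · left
    push Not at h
    exact le_bot_iff.1 fun x hx => (TwoSidedIdeal.mem_bot _).2 (h x hx)

lemma central_bc [FiniteDimensional L A] [IsSimpleRing A] [Algebra.IsCentral L A] :
    Algebra.IsCentral K (K ⊗[L] A) := by
  refine ⟨fun z hz => ?_⟩
  rw [Subalgebra.mem_center_iff] at hz
  let b := Module.Free.chooseBasis L A
  obtain ⟨i, hi⟩ : ∃ i, b.repr (1 : A) i ≠ 0 := by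
    by_contra! h
    exact one_ne_zero (b.repr.map_eq_zero_iff.1 (Finsupp.ext h))
  obtain ⟨T, hT, hTa⟩ := exists_coord b i
  have h1 := lT_center hz hT
  rw [lT_coord b i T hTa, hTa, Algebra.algebraMap_eq_smul_one, TensorProduct.tmul_smul,
    ← Algebra.TensorProduct.one_def, mul_smul_comm, mul_one] at h1
  rw [Algebra.mem_bot]
  refine ⟨algebraMap L K (b.repr 1 i)⁻¹ * (b.baseChange K).repr z i, ?_⟩
  rw [Algebra.TensorProduct.algebraMap_apply, Algebra.algebraMap_self_apply, ← Algebra.smul_def,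
    ← TensorProduct.smul_tmul', h1, smul_smul, inv_mul_cancel₀ hi, one_smul]

end density
end BT

namespace BT
open Polynomial

lemma isCSA_bc {L A K : Type u} [Field L] [Ring A] [Algebra L A] [Field K] [Algebra L K]
    (h : IsCSA L A) : IsCSA K (K ⊗[L] A) := by
  obtain ⟨h1, h2, h3⟩ := h
  exact ⟨inferInstance, central_bc, simple_bc⟩

/-- cancel base change for a noncommutative algebra -/
noncomputable def cancelBC (R S T A : Type u) [CommRing R] [CommRing S] [CommRing T] [Ring A]
    [Algebra R S] [Algebra R T] [Algebra S T] [IsScalarTower R S T] [Algebra R A] :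
    T ⊗[S] (S ⊗[R] A) ≃ₐ[T] T ⊗[R] A :=
  (Algebra.TensorProduct.algEquivOfLinearEquivTensorProduct
    (AlgebraTensorModule.cancelBaseChange R S T T A).symm
    (fun a₁ a₂ b₁ b₂ => by simp) (by simp [Algebra.TensorProduct.one_def])).symm

lemma isCSA_congr {F A B : Type u} [Field F] [Ring A] [Algebra F A] [Ring B] [Algebra F B]
    (e : A ≃ₐ[F] B) (h : IsCSA F A) : IsCSA F B := by
  obtain ⟨h1, h2, h3⟩ := h
  exact ⟨e.toLinearEquiv.finiteDimensional, Algebra.IsCentral.of_algEquiv F A B e,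
    IsSimpleRing.of_ringEquiv e.toRingEquiv h3⟩

lemma unramified {k L F A : Type u} [Field k] [Field L] [Field F] [Algebra k L] [Algebra k F]
    [Algebra L F] [IsScalarTower k L F] [FiniteDimensional k L] [Ring A] [Algebra L A]
    (hA : IsCSA L A) (O : ValuationSubring F) (hO : ∀ c : k, algebraMap k F c ∈ O) :
    UnramifiedAt F O (F ⊗[L] A) := by
  have hL : ∀ c : L, algebraMap L F c ∈ O := by
    intro c
    letI : Algebra k O := ((algebraMap k F).codRestrict O.toSubring hO).toAlgebra
    haveI : IsScalarTower k O F := IsScalarTower.of_algebraMap_eq (fun _ => rfl)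
    have h1 : IsIntegral k (algebraMap L F c) :=
      (Algebra.IsIntegral.isIntegral (R := k) c).map (IsScalarTower.toAlgHom k L F)
    have h2 : IsIntegral O (algebraMap L F c) := h1.tower_top
    obtain ⟨y, hy⟩ := IsIntegrallyClosed.isIntegral_iff.1 h2
    rw [← hy]; exact y.2
  letI : Algebra L O := ((algebraMap L F).codRestrict O.toSubring hL).toAlgebra
  haveI : IsScalarTower L O F := IsScalarTower.of_algebraMap_eq (fun _ => rfl)
  have := hA.1
  refine ⟨O ⊗[L] A, inferInstance, inferInstance, ⟨inferInstance, inferInstance, ?_⟩, ⟨?_⟩⟩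
  · exact isCSA_congr (cancelBC L O (IsLocalRing.ResidueField O) A).symm (isCSA_bc hA)
  · exact cancelBC L O F A

lemma curve (k L : Type u) [Field k] [Field L] [Algebra k L] [FiniteDimensional k L] :
    IsCurveFunctionField k (RatFunc L) := by
  constructor
  · have h1 : Algebra.EssFiniteType L[X] (RatFunc L) :=
      Algebra.EssFiniteType.of_isLocalization _ (nonZeroDivisors L[X])
    have h2 : Algebra.EssFiniteType k (RatFunc L) := Algebra.EssFiniteType.comp k L[X] _
    exact IntermediateField.fg_top k (RatFunc L)
  · refine ⟨RatFunc.X, RatFunc.transcendental_X.of_tower_top k (L := L), ⟨fun g => ?_⟩⟩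
    have hp : ∀ p : L[X], IsAlgebraic (IntermediateField.adjoin k ({RatFunc.X} : Set (RatFunc L)))
        (algebraMap L[X] (RatFunc L) p) := by
      have hX : IsAlgebraic (IntermediateField.adjoin k ({RatFunc.X} : Set (RatFunc L)))
        (RatFunc.X : RatFunc L) :=
        isAlgebraic_algebraMap
          (⟨RatFunc.X, IntermediateField.mem_adjoin_simple_self k _⟩ :
            IntermediateField.adjoin k ({RatFunc.X} : Set (RatFunc L)))
      intro p
      induction p using Polynomial.induction_on' with
      | add p q hp hq => rw [map_add]; exact hp.add hq
      | monomial n a =>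
        rw [← Polynomial.C_mul_X_pow_eq_monomial, map_mul, map_pow, RatFunc.algebraMap_X]
        refine IsAlgebraic.mul ?_ (hX.pow n)
        have : IsAlgebraic k (algebraMap L (RatFunc L) a) :=
          (Algebra.IsAlgebraic.isAlgebraic (R := k) a).algebraMap
        exact this.tower_top _
    rw [← RatFunc.num_div_denom g, div_eq_mul_inv]
    exact (hp _).mul (hp _).inv

lemma descent {L A F : Type u} [Field L] [Ring A] [Algebra L A] [Field F] [Algebra L F]
    [Algebra L[X] F] [IsScalarTower L L[X] F] [IsFractionRing L[X] F]
    (hA : IsCSA L A) (h : IsMatrixAlgebra F (F ⊗[L] A)) : IsMatrixAlgebra L A := by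
  obtain ⟨hfd, -, hs⟩ := hA
  obtain ⟨n, hn, ⟨e⟩⟩ := h
  have hdim : Module.finrank L A = n * n := by
    rw [← Module.finrank_baseChange (R := F), e.toLinearEquiv.finrank_eq, Module.finrank_matrix]
    simp
  let f : A →ₐ[L] Module.End F (Fin n → F) :=
    ((e.trans Matrix.toLinAlgEquiv').toAlgHom.restrictScalars L).comp
      Algebra.TensorProduct.includeRight
  let b := Module.Free.chooseBasis L A
  let v : Fin n → (Fin n → F) := fun j => Pi.single j 1
  let M : Submodule L[X] (Fin n → F) :=
    Submodule.span L[X] (Set.range fun p : _ × Fin n => f (b p.1) (v p.2))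
  have hgen : ∀ a j, f a (v j) ∈ M := by
    intro a j
    rw [← b.sum_repr a, map_sum, LinearMap.sum_apply]
    refine sum_mem fun i _ => ?_
    rw [map_smul, LinearMap.smul_apply, ← algebraMap_smul L[X] (b.repr a i)]
    exact M.smul_mem _ (Submodule.subset_span ⟨(i, j), rfl⟩)
  have hstab : ∀ a, ∀ x ∈ M, (f a).restrictScalars L[X] x ∈ M := by
    intro a
    change M ≤ M.comap ((f a).restrictScalars L[X])
    refine Submodule.span_le.2 ?_
    rintro _ ⟨⟨i, j⟩, rfl⟩
    change f a (f (b i) (v j)) ∈ M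
    rw [← Module.End.mul_apply, ← map_mul]
    exact hgen _ _
  have hMfin : Module.Finite L[X] M :=
    Module.Finite.iff_fg.2 (Submodule.fg_span (Set.finite_range _))
  have : IsDomain L[X] := inferInstance
  have : Module.IsTorsionFree L[X] F := inferInstance
  have : Module.IsTorsionFree L[X] (Fin n → F) := inferInstance
  have hfree : Module.Free L[X] M := inferInstance
  have hnt : Nontrivial M := by
    refine ⟨⟨⟨f 1 (v ⟨0, hn⟩), hgen _ _⟩, 0, fun h => ?_⟩⟩
    have h1 := congrFun (congrArg Subtype.val h) ⟨0, hn⟩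
    simp [v] at h1
  let B := Module.Free.chooseBasis L[X] M
  set ι := Module.Free.ChooseBasisIndex L[X] M with hι
  have hne : Nonempty ι := B.index_nonempty
  classical
  have hcard : Fintype.card ι ≤ n := by
    have h1 : LinearIndependent L[X] (fun i => (B i : Fin n → F)) :=
      B.linearIndependent.map' M.subtype (by simp)
    have h2 := ((LinearIndependent.iff_fractionRing L[X] F).1 h1).fintype_card_le_finrank
    simpa using h2
  let ρ : A →+* Module.End L[X] M :=
    { toFun := fun a => ((f a).restrictScalars L[X]).restrict (hstab a)
      map_one' := by ext x; simp
      map_zero' := by ext x; simp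
      map_mul' := fun x y => by ext z; simp
      map_add' := fun x y => by ext z; simp }
  let φ : A →ₐ[L] Matrix ι ι L :=
    { (((Polynomial.evalRingHom (0 : L)).mapMatrix).comp
        ((LinearMap.toMatrixAlgEquiv B : _ ≃ₐ[L[X]] Matrix ι ι L[X]) : _ →+* Matrix ι ι L[X])).comp ρ with
      commutes' := fun c => by
        have h1 : ρ (algebraMap L A c) = algebraMap L[X] _ (C c) := by
          ext x : 1
          apply Subtype.ext
          change f (algebraMap L A c) x = (C c) • (x : Fin n → F)
          rw [AlgHom.commutes, Module.algebraMap_end_apply, ← Polynomial.algebraMap_eq,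
            algebraMap_smul]
        simp only [RingHom.toMonoidHom_eq_coe, OneHom.toFun_eq_coe, MonoidHom.toOneHom_coe,
          MonoidHom.coe_coe, RingHom.comp_apply, h1]
        simp only [RingHom.coe_coe, AlgEquiv.commutes]
        ext i j
        by_cases hij : i = j <;> simp [Matrix.algebraMap_matrix_apply, hij] }
  have hinj : Function.Injective φ := φ.toRingHom.injective
  have hle := LinearMap.finrank_le_finrank_of_injective (f := φ.toLinearMap) hinj
  rw [hdim, Module.finrank_matrix, Module.finrank_self, mul_one] at hle
  have hcn : Fintype.card ι = n := by
    refine le_antisymm hcard ?_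
    by_contra! hlt
    have := Nat.mul_lt_mul'' hlt hlt
    omega
  have hbij : Function.Bijective φ := by
    refine ⟨hinj, ?_⟩
    refine (LinearMap.injective_iff_surjective_of_finrank_eq_finrank (f := φ.toLinearMap) ?_).1 hinj
    rw [hdim, Module.finrank_matrix, Module.finrank_self, mul_one, hcn]
  exact ⟨n, hn, ⟨(AlgEquiv.ofBijective φ hbij).trans
    (Matrix.reindexAlgEquiv L L (Fintype.equivFinOfCardEq hcn))⟩⟩

end BT

theorem brauer_trivial_of_isB1
    (k L : Type u) [Field k] [Field L] [Algebra k L] [FiniteDimensional k L]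
    (hB1 : IsB1 k) : BrauerTrivial L := by
  intro A _ _ hA
  exact BT.descent (F := RatFunc L) hA (hB1 (RatFunc L) (BT.curve k L) _ (BT.isCSA_bc hA)
    (fun O hO => BT.unramified (k := k) hA O hO))
end

section
/- If k is a B1 field of characteristic different from 2, then every quadratic form of rank at least 3 over k is isotropic (has a nontrivial zero). -/
universe u

open TensorProduct

/-- The standard quaternion basis of the base-changed quaternion algebra, over the small ring. -/
def quatB1 (R S : Type u) [CommRing R] [CommRing S] [Algebra R S] (a b : R) :
    QuaternionAlgebra.Basis
      (QuaternionAlgebra S (algebraMap R S a) 0 (algebraMap R S b)) a 0 b where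
  i := ⟨0, 1, 0, 0⟩
  j := ⟨0, 0, 1, 0⟩
  k := ⟨0, 0, 0, 1⟩
  i_mul_i := by ext <;> simp [Algebra.algebraMap_eq_smul_one]
  j_mul_j := by ext <;> simp [Algebra.algebraMap_eq_smul_one]
  i_mul_j := by ext <;> simp
  j_mul_i := by ext <;> simp

/-- The standard quaternion basis of a quaternion algebra. -/
abbrev quatSelf (R : Type u) [CommRing R] (a b : R) :
    QuaternionAlgebra.Basis (QuaternionAlgebra R a 0 b) a 0 b := QuaternionAlgebra.Basis.self R

/-- The quaternion basis of the tensor product. -/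
noncomputable def quatB2 (R S : Type u) [CommRing R] [CommRing S] [Algebra R S] (a b : R) :
    QuaternionAlgebra.Basis (S ⊗[R] QuaternionAlgebra R a 0 b)
      (algebraMap R S a) 0 (algebraMap R S b) where
  i := 1 ⊗ₜ (quatSelf R a b).i
  j := 1 ⊗ₜ (quatSelf R a b).j
  k := 1 ⊗ₜ (quatSelf R a b).k
  i_mul_i := by
    rw [Algebra.TensorProduct.tmul_mul_tmul, QuaternionAlgebra.Basis.i_mul_i]
    simp [Algebra.TensorProduct.one_def]
  j_mul_j := by
    rw [Algebra.TensorProduct.tmul_mul_tmul, QuaternionAlgebra.Basis.j_mul_j]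
    simp [Algebra.TensorProduct.one_def]
  i_mul_j := by
    rw [Algebra.TensorProduct.tmul_mul_tmul, QuaternionAlgebra.Basis.i_mul_j, one_mul]
  j_mul_i := by
    rw [Algebra.TensorProduct.tmul_mul_tmul, QuaternionAlgebra.Basis.j_mul_i]
    rw [zero_smul, zero_smul, zero_sub, zero_sub, TensorProduct.tmul_neg, mul_one]

theorem quatB_lift_i {R A : Type*} [CommRing R] [Ring A] [Algebra R A] {a b : R}
    (B : QuaternionAlgebra.Basis A a 0 b) : B.liftHom ⟨0, 1, 0, 0⟩ = B.i := by
  simp [QuaternionAlgebra.Basis.lift]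

theorem quatB_lift_j {R A : Type*} [CommRing R] [Ring A] [Algebra R A] {a b : R}
    (B : QuaternionAlgebra.Basis A a 0 b) : B.liftHom ⟨0, 0, 1, 0⟩ = B.j := by
  simp [QuaternionAlgebra.Basis.lift]

/-- The map from the tensor product to the base-changed quaternion algebra. -/
noncomputable def quatMap (R S : Type u) [CommRing R] [CommRing S] [Algebra R S] (a b : R) :
    (S ⊗[R] QuaternionAlgebra R a 0 b) →ₐ[S]
      QuaternionAlgebra S (algebraMap R S a) 0 (algebraMap R S b) :=
  Algebra.TensorProduct.lift (Algebra.ofId S _) (quatB1 R S a b).liftHom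
      (fun s _ => show Commute _ _ from Algebra.commutes s _)

theorem quatMap_tmul (R S : Type u) [CommRing R] [CommRing S] [Algebra R S] (a b : R)
    (x : QuaternionAlgebra R a 0 b) :
    quatMap R S a b (1 ⊗ₜ x) = (quatB1 R S a b).liftHom x := by
  unfold quatMap
  rw [Algebra.TensorProduct.lift_tmul, map_one, one_mul]

/-- Quaternion algebras commute with base change. -/
noncomputable def quatBaseChange (R S : Type u) [CommRing R] [CommRing S] [Algebra R S] (a b : R) :
    (S ⊗[R] QuaternionAlgebra R a 0 b) ≃ₐ[S]
      QuaternionAlgebra S (algebraMap R S a) 0 (algebraMap R S b) :=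
  AlgEquiv.ofAlgHom (quatMap R S a b) (quatB2 R S a b).liftHom
    (by
      apply QuaternionAlgebra.hom_ext
      · change quatMap R S a b ((quatB2 R S a b).liftHom ⟨0, 1, 0, 0⟩) = ⟨0, 1, 0, 0⟩
        rw [quatB_lift_i]
        exact (quatMap_tmul R S a b _).trans (quatB_lift_i _)
      · change quatMap R S a b ((quatB2 R S a b).liftHom ⟨0, 0, 1, 0⟩) = ⟨0, 0, 1, 0⟩
        rw [quatB_lift_j]
        exact (quatMap_tmul R S a b _).trans (quatB_lift_j _))
    (by
      apply Algebra.TensorProduct.ext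
      · ext
      · apply QuaternionAlgebra.hom_ext
        · change (quatB2 R S a b).liftHom (quatMap R S a b (1 ⊗ₜ ⟨0, 1, 0, 0⟩)) = 1 ⊗ₜ ⟨0, 1, 0, 0⟩
          rw [quatMap_tmul, quatB_lift_i]
          exact quatB_lift_i _
        · change (quatB2 R S a b).liftHom (quatMap R S a b (1 ⊗ₜ ⟨0, 0, 1, 0⟩)) = 1 ⊗ₜ ⟨0, 0, 1, 0⟩
          rw [quatMap_tmul, quatB_lift_j]
          exact quatB_lift_j _)

theorem quat_isCSA (F : Type u) [Field F] (h2 : (2 : F) ≠ 0) (a b : F) (ha : a ≠ 0) (hb : b ≠ 0) :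
    IsCSA F (QuaternionAlgebra F a 0 b) := by
  refine ⟨inferInstance, ⟨?_⟩, ?_⟩
  · intro x hx
    rw [Subalgebra.mem_center_iff] at hx
    have h1 := hx ⟨0, 1, 0, 0⟩
    have h3 := hx ⟨0, 0, 1, 0⟩
    rw [QuaternionAlgebra.ext_iff] at h1 h3
    simp at h1 h3
    have e1 : x.imI = 0 := by
      have : 2 * x.imI = 0 := by linear_combination -h3.2
      simpa [h2] using this
    have e2 : x.imJ = 0 := by
      have : 2 * x.imJ = 0 := by linear_combination h1.2
      simpa [h2] using this
    have e3 : x.imK = 0 := by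
      have : (2 * a) * x.imK = 0 := by linear_combination h1.1
      simpa [h2, ha] using this
    rw [Algebra.mem_bot]
    exact ⟨x.re, by ext <;> simp [e1, e2, e3]⟩
  · have : Nontrivial (QuaternionAlgebra F a 0 b) :=
      ⟨0, 1, fun h => by simpa using congrArg QuaternionAlgebra.re h⟩
    apply IsSimpleRing.of_eq_bot_or_eq_top
    intro I
    rw [or_iff_not_imp_left]
    intro hI
    -- real parts of elements of I must vanish unless I is everything
    have key : ∀ x ∈ I, x.re ≠ 0 → I = ⊤ := by
      intro x hx hr
      have h4 : (4 : F) ≠ 0 := by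
        have : (4 : F) = 2 * 2 := by norm_num
        rw [this]; exact mul_ne_zero h2 h2
      have hm : x + ⟨0, 1, 0, 0⟩ * x * ⟨0, a⁻¹, 0, 0⟩ + ⟨0, 0, 1, 0⟩ * x * ⟨0, 0, b⁻¹, 0⟩
          + ⟨0, 0, 0, 1⟩ * x * ⟨0, 0, 0, -(a * b)⁻¹⟩ ∈ I := by
        refine I.add_mem (I.add_mem (I.add_mem hx ?_) ?_) ?_ <;>
        exact I.mul_mem_right _ _ (I.mul_mem_left _ _ hx)
      have he : x + ⟨0, 1, 0, 0⟩ * x * ⟨0, a⁻¹, 0, 0⟩ + ⟨0, 0, 1, 0⟩ * x * ⟨0, 0, b⁻¹, 0⟩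
          + ⟨0, 0, 0, 1⟩ * x * ⟨0, 0, 0, -(a * b)⁻¹⟩
          = (⟨4 * x.re, 0, 0, 0⟩ : QuaternionAlgebra F a 0 b) := by
        ext <;> simp <;> field_simp <;> ring
      rw [he] at hm
      have := I.mul_mem_left ⟨(4 * x.re)⁻¹, 0, 0, 0⟩ _ hm
      have h1 : (⟨(4 * x.re)⁻¹, 0, 0, 0⟩ * ⟨4 * x.re, 0, 0, 0⟩ : QuaternionAlgebra F a 0 b) = 1 := by
        ext <;> simp
        field_simp
      rw [h1] at this
      exact (TwoSidedIdeal.one_mem_iff I).1 this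
    by_contra hT
    apply hI
    rw [eq_bot_iff]
    intro x hx
    have z : ∀ y, (x * y).re = 0 := fun y => by
      by_contra h
      exact hT (key _ (I.mul_mem_right _ _ hx) h)
    have z0 := z ⟨1, 0, 0, 0⟩
    have z1 := z ⟨0, 1, 0, 0⟩
    have z2 := z ⟨0, 0, 1, 0⟩
    have z3 := z ⟨0, 0, 0, 1⟩
    simp [ha, hb] at z0 z1 z2 z3
    rw [TwoSidedIdeal.mem_bot]
    ext <;> simp [*]

theorem IsCSA.of_algEquiv {F A B : Type u} [Field F] [Ring A] [Ring B] [Algebra F A] [Algebra F B]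
    (e : A ≃ₐ[F] B) (h : IsCSA F A) : IsCSA F B := by
  obtain ⟨h1, h2, h3⟩ := h
  exact ⟨Module.Finite.equiv e.toLinearEquiv, Algebra.IsCentral.of_algEquiv F A B e,
    IsSimpleRing.of_ringEquiv e.toRingEquiv h3⟩

theorem quat_unramified (k F : Type u) [Field k] [Field F] [Algebra k F] (h2 : (2 : k) ≠ 0)
    (a b : k) (ha : a ≠ 0) (hb : b ≠ 0) (O : ValuationSubring F)
    (hO : ∀ c : k, algebraMap k F c ∈ O) :
    UnramifiedAt F O (QuaternionAlgebra F (algebraMap k F a) 0 (algebraMap k F b)) := by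
  let f : k →+* O := (algebraMap k F).codRestrict O.toSubring hO
  refine ⟨QuaternionAlgebra O (f a) 0 (f b), inferInstance, inferInstance,
    ⟨inferInstance, inferInstance, ?_⟩, ⟨?_⟩⟩
  · refine IsCSA.of_algEquiv (quatBaseChange O (IsLocalRing.ResidueField O) (f a) (f b)).symm ?_
    let g : k →+* IsLocalRing.ResidueField O := (IsLocalRing.residue O).comp f
    apply quat_isCSA
    · have := (map_ne_zero g).2 h2
      rwa [map_ofNat] at this
    · exact (map_ne_zero g).2 ha
    · exact (map_ne_zero g).2 hb
  · exact quatBaseChange O F (f a) (f b)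

/-- A split quaternion algebra has an isotropic pure part. -/
theorem quat_split_isotropic (F : Type u) [Field F] (h2 : (2 : F) ≠ 0) (a b : F)
    (h : IsMatrixAlgebra F (QuaternionAlgebra F a 0 b)) :
    ∃ x y z : F, (x ≠ 0 ∨ y ≠ 0 ∨ z ≠ 0) ∧ a * x ^ 2 + b * y ^ 2 - a * b * z ^ 2 = 0 := by
  obtain ⟨n, hn, ⟨e⟩⟩ := h
  have hd : n * n = 4 := by
    have := e.toLinearEquiv.finrank_eq
    rw [QuaternionAlgebra.finrank_eq_four, Module.finrank_matrix] at this
    simpa using this.symm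
  obtain rfl : n = 2 := by nlinarith
  let N : Matrix (Fin 2) (Fin 2) F := !![0, 1; 0, 0]
  have hN : N * N = 0 := by ext i j; fin_cases i <;> fin_cases j <;> simp [N]
  have hN0 : N ≠ 0 := fun h => by simpa [N] using congrFun (congrFun h 0) 1
  set q := e.symm N with hq
  have hq0 : q ≠ 0 := by simpa [hq] using hN0
  have hqq : q * q = 0 := by rw [hq, ← map_mul, hN, map_zero]
  have hc := QuaternionAlgebra.ext_iff.1 hqq
  simp at hc
  obtain ⟨c0, c1, c2, c3⟩ := hc
  have hr : q.re = 0 := by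
    by_contra hr
    have e1 : q.imI = 0 := by
      have : (2 * q.re) * q.imI = 0 := by linear_combination c1
      simpa [h2, hr] using this
    have e2 : q.imJ = 0 := by
      have : (2 * q.re) * q.imJ = 0 := by linear_combination c2
      simpa [h2, hr] using this
    have e3 : q.imK = 0 := by
      have : (2 * q.re) * q.imK = 0 := by linear_combination c3
      simpa [h2, hr] using this
    simp [e1, e2, e3, hr] at c0
  refine ⟨q.imI, q.imJ, q.imK, ?_, ?_⟩
  · by_contra hh
    push Not at hh
    exact hq0 (by ext <;> simp [hr, hh])
  · rw [hr] at c0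
    linear_combination c0

open Polynomial in
/-- An anisotropic diagonal ternary form stays anisotropic over polynomials. -/
theorem aniso_poly (k : Type u) [Field k] (a b c : k)
    (h : ∀ x y z : k, a * x ^ 2 + b * y ^ 2 + c * z ^ 2 = 0 → x = 0 ∧ y = 0 ∧ z = 0)
    (d : ℕ) : ∀ (p q r : k[X]), p.natDegree ≤ d → q.natDegree ≤ d → r.natDegree ≤ d →
    C a * p ^ 2 + C b * q ^ 2 + C c * r ^ 2 = 0 → p = 0 ∧ q = 0 ∧ r = 0 := by
  have step : ∀ (d : ℕ) (p q r : k[X]), p.natDegree ≤ d → q.natDegree ≤ d → r.natDegree ≤ d →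
    C a * p ^ 2 + C b * q ^ 2 + C c * r ^ 2 = 0 →
      p.coeff d = 0 ∧ q.coeff d = 0 ∧ r.coeff d = 0 := by
    intro d p q r hp hq hr he
    apply h
    have := congrArg (fun s => coeff s (2 * d)) he
    simpa [coeff_C_mul, coeff_pow_of_natDegree_le, hp, hq, hr] using this
  induction d with
  | zero =>
    intro p q r hp hq hr he
    obtain ⟨h1, h2, h3⟩ := step 0 p q r hp hq hr he
    rw [eq_C_of_natDegree_le_zero hp, eq_C_of_natDegree_le_zero hq,
      eq_C_of_natDegree_le_zero hr, h1, h2, h3]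
    simp
  | succ d ih =>
    intro p q r hp hq hr he
    obtain ⟨h1, h2, h3⟩ := step _ p q r hp hq hr he
    have aux : ∀ s : k[X], s.natDegree ≤ d + 1 → s.coeff (d + 1) = 0 → s.natDegree ≤ d := by
      intro s hs hc
      by_contra hlt
      have hd : s.natDegree = d + 1 := by omega
      rw [← hd] at hc
      have : s = 0 := leadingCoeff_eq_zero.1 hc
      simp [this] at hd
    exact ih p q r (aux p hp h1) (aux q hq h2) (aux r hr h3) he

open Polynomial in
theorem aniso_ratFunc (k : Type u) [Field k] (a b c : k)
    (h : ∀ x y z : k, a * x ^ 2 + b * y ^ 2 + c * z ^ 2 = 0 → x = 0 ∧ y = 0 ∧ z = 0)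
    (x y z : RatFunc k)
    (he : algebraMap k (RatFunc k) a * x ^ 2 + algebraMap k (RatFunc k) b * y ^ 2
      + algebraMap k (RatFunc k) c * z ^ 2 = 0) : x = 0 ∧ y = 0 ∧ z = 0 := by
  classical
  obtain ⟨d, hd⟩ := IsLocalization.exist_integer_multiples_of_finset (nonZeroDivisors k[X])
    ({x, y, z} : Finset (RatFunc k))
  obtain ⟨p, hp⟩ := hd x (by simp)
  obtain ⟨q, hq⟩ := hd y (by simp)
  obtain ⟨r, hr⟩ := hd z (by simp)
  have hinj : Function.Injective (algebraMap k[X] (RatFunc k)) := IsFractionRing.injective _ _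
  have hd0 : algebraMap k[X] (RatFunc k) d ≠ 0 := by
    rw [Ne, map_eq_zero_iff _ hinj]; exact nonZeroDivisors.coe_ne_zero d
  rw [Algebra.smul_def] at hp hq hr
  have hC : ∀ t : k, algebraMap k[X] (RatFunc k) (C t) = algebraMap k (RatFunc k) t := fun t => by
    rw [IsScalarTower.algebraMap_apply k k[X] (RatFunc k)]; rfl
  have := aniso_poly k a b c h (p.natDegree + q.natDegree + r.natDegree) p q r (by omega)
    (by omega) (by omega) (by
      apply hinj
      simp only [map_add, map_mul, map_pow, map_zero, hC, hp, hq, hr]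
      linear_combination (algebraMap k[X] (RatFunc k) d) ^ 2 * he)
  obtain ⟨rfl, rfl, rfl⟩ := this
  simp [hd0] at hp hq hr
  exact ⟨hp, hq, hr⟩

theorem ratFunc_curve (k : Type u) [Field k] : IsCurveFunctionField k (RatFunc k) := by
  have ht : IntermediateField.adjoin k ({RatFunc.X} : Set (RatFunc k)) = ⊤ := by
    exact RatFunc.adjoin_X
  refine ⟨⟨{RatFunc.X}, by simpa using ht⟩, RatFunc.X, ?_, ?_⟩
  · exact RatFunc.transcendental_X
  · constructor
    intro x
    have : x ∈ IntermediateField.adjoin k ({RatFunc.X} : Set (RatFunc k)) := by simp [ht]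
    exact isAlgebraic_algebraMap (⟨x, this⟩ : IntermediateField.adjoin k {RatFunc.X})

/-- Over a B₁ field of characteristic not two, a ternary diagonal form is isotropic. -/
theorem diag_isotropic (k : Type u) [Field k] (hchar : (2 : k) ≠ 0) (hB1 : IsB1 k) (a b c : k)
    (ha : a ≠ 0) (hb : b ≠ 0) (hc : c ≠ 0) :
    ¬ ∀ x y z : k, a * x ^ 2 + b * y ^ 2 + c * z ^ 2 = 0 → x = 0 ∧ y = 0 ∧ z = 0 := by
  intro h
  have h2 : (2 : RatFunc k) ≠ 0 := by
    have := (map_ne_zero (algebraMap k (RatFunc k))).2 hchar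
    rwa [map_ofNat] at this
  have inj : ∀ t : k, t ≠ 0 → algebraMap k (RatFunc k) t ≠ 0 := fun t ht =>
    (map_ne_zero (algebraMap k (RatFunc k))).2 ht
  have ha' : -(b * c) ≠ 0 := neg_ne_zero.2 (mul_ne_zero hb hc)
  have hb' : -(c * a) ≠ 0 := neg_ne_zero.2 (mul_ne_zero hc ha)
  have hs := hB1 (RatFunc k) (ratFunc_curve k)
    (QuaternionAlgebra (RatFunc k) (algebraMap k _ (-(b * c))) 0 (algebraMap k _ (-(c * a))))
    (quat_isCSA _ h2 _ _ (inj _ ha') (inj _ hb'))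
    (fun O hO => quat_unramified k _ hchar _ _ ha' hb' O hO)
  obtain ⟨x, y, z, hne, he⟩ := quat_split_isotropic _ h2 _ _ hs
  have A := inj a ha
  have B := inj b hb
  have D := inj c hc
  simp only [map_neg, map_mul] at he
  obtain ⟨r1, r2, r3⟩ := aniso_ratFunc k a b c h (algebraMap k _ b * x) (algebraMap k _ a * y)
    (algebraMap k _ a * algebraMap k _ b * z) (by
      apply mul_left_cancel₀ D
      linear_combination (-(algebraMap k (RatFunc k) a * algebraMap k (RatFunc k) b)) * he)
  simp [ha, hb] at r1 r2 r3
  simp [r1, r2, r3] at hne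

/-!
STATEMENT 2: If `k` is a B₁ field of characteristic ≠ 2, then every quadratic form of
rank at least 3 over `k` is isotropic.  Equivalently: every anisotropic quadratic form
over `k` has rank at most 2.
-/

theorem isotropic_of_rank_ge_three_of_isB1
    (k : Type u) [Field k] (hchar : (2 : k) ≠ 0) (hB1 : IsB1 k) :
    ∀ (n : ℕ) (Q : QuadraticForm k (Fin n → k)), Q.Anisotropic → n ≤ 2 := by
  intro n Q hQ
  by_contra hn
  push Not at hn
  have : Invertible (2 : k) := invertibleOfNonzero hchar
  obtain ⟨w, ⟨e⟩⟩ := QuadraticForm.equivalent_weightedSumSquares Q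
  have hW : ∀ v, QuadraticMap.weightedSumSquares k w v = 0 → v = 0 := by
    intro v hv
    have h1 := hQ (e.symm v) (by rw [QuadraticMap.IsometryEquiv.map_app]; exact hv)
    have h2 := congrArg e h1
    rw [QuadraticMap.IsometryEquiv.apply_symm_apply] at h2
    rw [h2]
    exact map_zero e.toLinearEquiv
  have hfin : Module.finrank k (Fin n → k) = n := by simp
  revert e w
  rw [hfin]
  intro w e hW
  obtain ⟨m, rfl⟩ : ∃ m, n = m + 3 := ⟨n - 3, by omega⟩
  have hd : ∀ x y z : k, w 0 * x ^ 2 + w 1 * y ^ 2 + w 2 * z ^ 2 = 0 → x = 0 ∧ y = 0 ∧ z = 0 := by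
    intro x y z h
    have := hW (Fin.cons x (Fin.cons y (Fin.cons z 0))) (by
      rw [QuadraticMap.weightedSumSquares_apply]
      simp [Fin.sum_univ_succ]
      linear_combination h)
    have t0 := congrFun this 0
    have t1 := congrFun this (Fin.succ 0)
    have t2 := congrFun this (Fin.succ (Fin.succ 0))
    exact ⟨by simpa using t0, by simpa using t1, t2⟩
  refine diag_isotropic k hchar hB1 (w 0) (w 1) (w 2) ?_ ?_ ?_ hd
  · intro h
    simpa using (hd 1 0 0 (by simp [h])).1
  · intro h
    simpa using (hd 0 1 0 (by simp [h])).2.1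
  · intro h
    simpa using (hd 0 0 1 (by simp [h])).2.2
end

section
/- Let p be a prime with p congruent to 3 mod 4, k = F_p, R = k[[x,y]], and K = Frac(R) = k((x,y)). Then the Brauer class of the biquaternion algebra (-1, y) tensor (y+x, x) over K has order 2 and index 4; in particular it is a division algebra of degree 4. -/
open Polynomial
section part1

lemma bq_sq_add_sq {p : ℕ} [Fact p.Prime] (hp : p % 4 = 3) (a b : ZMod p)
    (h : a ^ 2 + b ^ 2 = 0) : a = 0 ∧ b = 0 := by
  have hb : b = 0 := by
    by_contra hb
    have : IsSquare (-1 : ZMod p) := ⟨a / b, by field_simp; linear_combination -h⟩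
    exact (ZMod.exists_sq_eq_neg_one_iff.mp this) hp
  subst hb
  simpa using h

lemma bq_two {p : ℕ} [Fact p.Prime] (hp : p % 4 = 3) : (2 : ZMod p) ≠ 0 := by
  have : (-1 : ZMod p) ≠ 1 := by
    intro h
    have := ZMod.exists_sq_eq_neg_one_iff (p := p) |>.mp ⟨1, by simpa using h⟩
    exact this hp
  intro h
  apply this
  linear_combination -h

lemma bq_dvd {p : ℕ} [Fact p.Prime] (hp : p % 4 = 3) (f g : (ZMod p)[X])
    (h : (X - C 1) ∣ f ^ 2 + g ^ 2) : (X - C 1) ∣ f ∧ (X - C 1) ∣ g := by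
  simp only [dvd_iff_isRoot, IsRoot.def, eval_add, eval_pow] at *
  exact bq_sq_add_sq hp _ _ h

lemma bq_aniso_aux {p : ℕ} [Fact p.Prime] (hp : p % 4 = 3) (n : ℕ) :
    ∀ a : Fin 4 → (ZMod p)[X],
    a 0 ^ 2 + a 1 ^ 2 = (X ^ 2 - 1) * (a 2 ^ 2 + a 3 ^ 2) → ∀ i, (X - C 1) ^ n ∣ a i := by
  induction n with
  | zero => intro a _ i; simp
  | succ n ih =>
    intro a h
    have h01 : (X - C 1) ∣ a 0 ^ 2 + a 1 ^ 2 := by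
      rw [h]; exact ⟨(X + 1) * (a 2 ^ 2 + a 3 ^ 2), by rw [C_1]; ring⟩
    obtain ⟨⟨b0, h0⟩, ⟨b1, h1⟩⟩ := bq_dvd hp _ _ h01
    have hne : (X - C 1 : (ZMod p)[X]) ≠ 0 := X_sub_C_ne_zero 1
    have h' : (X - C 1) * (b0 ^ 2 + b1 ^ 2) = (X + 1) * (a 2 ^ 2 + a 3 ^ 2) := by
      apply mul_left_cancel₀ hne
      rw [h0, h1] at h
      rw [C_1] at *
      linear_combination h
    have h23 : (X - C 1) ∣ a 2 ^ 2 + a 3 ^ 2 := by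
      have : (X - C 1) ∣ (X + 1) * (a 2 ^ 2 + a 3 ^ 2) := ⟨_, h'.symm⟩
      rcases (prime_X_sub_C (1 : ZMod p)).dvd_or_dvd this with h | h
      · exfalso
        rw [dvd_iff_isRoot] at h
        simp only [IsRoot.def, eval_add, eval_X, eval_one] at h
        exact bq_two hp (by linear_combination h)
      · exact h
    obtain ⟨⟨b2, h2⟩, ⟨b3, h3⟩⟩ := bq_dvd hp _ _ h23
    have key := ih ![b0, b1, b2, b3] (by
      simp only [Matrix.cons_val]
      apply mul_left_cancel₀ hne
      rw [h', h2, h3, C_1]; ring)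
    have k0 := key 0
    have k1 := key 1
    have k2 := key 2
    have k3 := key 3
    simp only [Matrix.cons_val] at k0 k1 k2 k3
    intro i
    rw [pow_succ']
    fin_cases i
    · change _ ∣ a 0; rw [h0]; exact mul_dvd_mul_left _ k0
    · change _ ∣ a 1; rw [h1]; exact mul_dvd_mul_left _ k1
    · change _ ∣ a 2; rw [h2]; exact mul_dvd_mul_left _ k2
    · change _ ∣ a 3; rw [h3]; exact mul_dvd_mul_left _ k3

lemma bq_aniso {p : ℕ} [Fact p.Prime] (hp : p % 4 = 3) (a : Fin 4 → (ZMod p)[X])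
    (h : a 0 ^ 2 + a 1 ^ 2 = (X ^ 2 - 1) * (a 2 ^ 2 + a 3 ^ 2)) : ∀ i, a i = 0 := by
  intro i
  by_contra hne
  have h1 := natDegree_le_of_dvd (bq_aniso_aux hp ((a i).natDegree + 1) a h i) hne
  rw [natDegree_pow, natDegree_X_sub_C] at h1
  omega

/-- The quartic form: the norm from `K(√(1+t))` of the reduced norm of `(-1,t)`. -/
def bqG {S : Type*} [CommRing S] (t : S) (a b : Fin 4 → S) : S :=
  (a 0 ^ 2 + a 1 ^ 2 - t * (a 2 ^ 2 + a 3 ^ 2)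
    + (1 + t) * (b 0 ^ 2 + b 1 ^ 2 - t * (b 2 ^ 2 + b 3 ^ 2))) ^ 2
  - (1 + t) * (2 * (a 0 * b 0 + a 1 * b 1 - t * (a 2 * b 2 + a 3 * b 3))) ^ 2

lemma bqG_map {S T : Type*} [CommRing S] [CommRing T] (φ : S →+* T) (t : S) (a b : Fin 4 → S) :
    φ (bqG t a b) = bqG (φ t) (fun i => φ (a i)) (fun i => φ (b i)) := by
  have h2 : φ 2 = 2 := map_ofNat φ 2
  simp [bqG, h2]

lemma bqG_smul {S : Type*} [CommRing S] (s t : S) (a b : Fin 4 → S) :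
    bqG t (fun i => s * a i) (fun i => s * b i) = s ^ 4 * bqG t a b := by
  simp only [bqG]; ring

lemma bq_even_odd {p : ℕ} [Fact p.Prime] (hp : p % 4 = 3) (a b : (ZMod p)[X])
    (h : a.comp (X ^ 2 - 1) + X * b.comp (X ^ 2 - 1) = 0) : a = 0 ∧ b = 0 := by
  have h' := congrArg (fun f => f.comp (-X)) h
  simp only [add_comp, mul_comp, comp_assoc, X_comp, sub_comp, pow_comp, one_comp, zero_comp,
    neg_sq] at h'
  have h2 : (2 : (ZMod p)[X]) ≠ 0 := by
    intro h
    apply bq_two hp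
    have := congrArg (eval 0) h
    simpa using this
  have hd : (X ^ 2 - 1 : (ZMod p)[X]).natDegree = 2 := by compute_degree!
  have inj : ∀ f : (ZMod p)[X], f.comp (X ^ 2 - 1) = 0 → f = 0 := by
    intro f hf
    rcases comp_eq_zero_iff.mp hf with h | h
    · exact h
    · exfalso
      have := congrArg natDegree h.2
      rw [natDegree_C, hd] at this
      omega
  constructor
  · apply inj
    apply mul_left_cancel₀ h2
    linear_combination h + h'
  · apply inj
    apply mul_left_cancel₀ h2
    apply mul_left_cancel₀ (X_ne_zero (R := ZMod p))
    linear_combination h - h'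

lemma bqG_poly {p : ℕ} [Fact p.Prime] (hp : p % 4 = 3) (a b : Fin 4 → (ZMod p)[X])
    (h : bqG X a b = 0) : ∀ i, a i = 0 ∧ b i = 0 := by
  have h1 := congrArg (compRingHom (X ^ 2 - 1)) h
  rw [bqG_map, map_zero] at h1
  set A := fun i => (compRingHom (X ^ 2 - 1)) (a i) with hA
  set B := fun i => (compRingHom (X ^ 2 - 1)) (b i) with hB
  have hX : (compRingHom (X ^ 2 - 1)) (X : (ZMod p)[X]) = X ^ 2 - 1 := by simp
  rw [hX] at h1
  have aux : ∀ s : (ZMod p)[X], s ^ 2 = X ^ 2 →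
      ((A 0 + s * B 0) ^ 2 + (A 1 + s * B 1) ^ 2
        - (X ^ 2 - 1) * ((A 2 + s * B 2) ^ 2 + (A 3 + s * B 3) ^ 2)) *
      ((A 0 - s * B 0) ^ 2 + (A 1 - s * B 1) ^ 2
        - (X ^ 2 - 1) * ((A 2 - s * B 2) ^ 2 + (A 3 - s * B 3) ^ 2)) = 0 := by
    intro s hs
    rw [← h1]
    simp only [bqG]
    rw [← hs]
    ring
  rcases mul_eq_zero.mp (aux X rfl) with h | h
  · have := bq_aniso hp (fun i => A i + X * B i) (by linear_combination h)
    intro i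
    exact bq_even_odd hp _ _ (by simpa [hA, hB] using this i)
  · have := bq_aniso hp (fun i => A i - X * B i) (by linear_combination h)
    intro i
    have := bq_even_odd hp (a i) (- b i) (by simpa [hA, hB, sub_eq_add_neg] using this i)
    simpa using this

lemma bqG_series_aux {p : ℕ} [Fact p.Prime] (hp : p % 4 = 3) (n : ℕ) :
    ∀ (a b : Fin 4 → PowerSeries (ZMod p)[X]) (d : PowerSeries (ZMod p)[X]),
    bqG (PowerSeries.C X) a b = PowerSeries.X ^ 2 * d ^ 4 →
    (∀ i, PowerSeries.X ^ n ∣ a i ∧ PowerSeries.X ^ n ∣ b i) ∧ PowerSeries.X ^ n ∣ d := by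
  induction n with
  | zero => intro a b d _; simp
  | succ n ih =>
    intro a b d h
    have h1 := congrArg (PowerSeries.constantCoeff) h
    rw [bqG_map] at h1
    simp only [PowerSeries.constantCoeff_C, map_mul, map_pow, PowerSeries.constantCoeff_X] at h1
    have h2 := bqG_poly hp _ _ (h1.trans (by ring))
    simp only [← PowerSeries.X_dvd_iff] at h2
    choose a' ha' using fun i => (h2 i).1
    choose b' hb' using fun i => (h2 i).2
    have hX : (PowerSeries.X : PowerSeries (ZMod p)[X]) ≠ 0 := PowerSeries.X_ne_zero
    have h3 : PowerSeries.X ^ 2 * bqG (PowerSeries.C X) a' b' = d ^ 4 := by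
      rw [funext ha', funext hb', bqG_smul] at h
      apply mul_left_cancel₀ (pow_ne_zero 2 hX)
      linear_combination h
    have h4 : PowerSeries.X ∣ d :=
      PowerSeries.X_prime.dvd_of_dvd_pow (n := 4)
        ⟨PowerSeries.X * bqG (PowerSeries.C X) a' b', by rw [← h3]; ring⟩
    obtain ⟨d', rfl⟩ := h4
    obtain ⟨k1, k2⟩ := ih a' b' d' (by
      apply mul_left_cancel₀ (pow_ne_zero 2 hX)
      rw [h3]; ring)
    simp only [pow_succ']
    refine ⟨fun i => ?_, mul_dvd_mul_left _ k2⟩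
    rw [ha', hb']
    exact ⟨mul_dvd_mul_left _ (k1 i).1, mul_dvd_mul_left _ (k1 i).2⟩

lemma bq_series_zero {S : Type*} [CommRing S] (f : PowerSeries S)
    (h : ∀ n, PowerSeries.X ^ n ∣ f) : f = 0 := by
  ext n
  exact (PowerSeries.X_pow_dvd_iff.mp (h (n + 1))) n (by omega)

lemma bqG_series {p : ℕ} [Fact p.Prime] (hp : p % 4 = 3)
    (a b : Fin 4 → PowerSeries (ZMod p)[X]) (d : PowerSeries (ZMod p)[X])
    (h : bqG (PowerSeries.C X) a b = PowerSeries.X ^ 2 * d ^ 4) :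
    (∀ i, a i = 0 ∧ b i = 0) ∧ d = 0 :=
  ⟨fun i => ⟨bq_series_zero _ fun n => ((bqG_series_aux hp n a b d h).1 i).1,
    bq_series_zero _ fun n => ((bqG_series_aux hp n a b d h).1 i).2⟩,
    bq_series_zero _ fun n => (bqG_series_aux hp n a b d h).2⟩

lemma bqG_frac {p : ℕ} [Fact p.Prime] (hp : p % 4 = 3) (F : Type*) [Field F]
    [Algebra (PowerSeries (ZMod p)[X]) F] [IsFractionRing (PowerSeries (ZMod p)[X]) F]
    (a b : Fin 4 → F) (d : F)
    (h : bqG (algebraMap (PowerSeries (ZMod p)[X]) F (PowerSeries.C X)) a b =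
      algebraMap (PowerSeries (ZMod p)[X]) F PowerSeries.X ^ 2 * d ^ 4) :
    (∀ i, a i = 0 ∧ b i = 0) ∧ d = 0 := by
  let w : Fin 4 ⊕ Fin 4 ⊕ Unit → F := Sum.elim a (Sum.elim b (fun _ => d))
  obtain ⟨s, hs⟩ := IsLocalization.exist_integer_multiples
    (nonZeroDivisors (PowerSeries (ZMod p)[X])) Finset.univ w
  choose w' hw' using fun i => hs i (Finset.mem_univ i)
  have hsne : algebraMap (PowerSeries (ZMod p)[X]) F s ≠ 0 :=
    IsFractionRing.to_map_ne_zero_of_mem_nonZeroDivisors s.2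
  simp only [Algebra.smul_def] at hw'
  have inj := IsFractionRing.injective (PowerSeries (ZMod p)[X]) F
  have ha : ∀ i, algebraMap _ F (w' (Sum.inl i)) = algebraMap _ F s.1 * a i := fun i => hw' _
  have hb : ∀ i, algebraMap _ F (w' (Sum.inr (Sum.inl i))) = algebraMap _ F s.1 * b i :=
    fun i => hw' _
  have hd : algebraMap _ F (w' (Sum.inr (Sum.inr ()))) = algebraMap _ F s.1 * d := hw' _
  obtain ⟨k1, k2⟩ := bqG_series hp (fun i => w' (Sum.inl i)) (fun i => w' (Sum.inr (Sum.inl i)))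
    (w' (Sum.inr (Sum.inr ()))) (by
      apply inj
      rw [bqG_map]
      simp only [ha, hb, hd, map_mul, map_pow]
      rw [bqG_smul, h]; ring)
  refine ⟨fun i => ⟨?_, ?_⟩, ?_⟩
  · have := ha i
    rw [(k1 i).1, map_zero] at this
    exact (mul_eq_zero.mp this.symm).resolve_left hsne
  · have := hb i
    rw [(k1 i).2, map_zero] at this
    exact (mul_eq_zero.mp this.symm).resolve_left hsne
  · rw [k2, map_zero] at hd
    exact (mul_eq_zero.mp hd.symm).resolve_left hsne

end part1
section part2

lemma bq_embed_exists (k : Type) [Field k] :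
    ∃ φ : MvPowerSeries (Fin 2) k →+* PowerSeries k[X], Function.Injective φ ∧
      φ (MvPowerSeries.X 0) = PowerSeries.X ∧
      φ (MvPowerSeries.X 1) = PowerSeries.C X * PowerSeries.X := by
  let v : Fin 2 → MvPowerSeries Unit k[X] :=
    ![(PowerSeries.X : PowerSeries k[X]), (PowerSeries.C X * PowerSeries.X : PowerSeries k[X])]
  have hv : MvPowerSeries.HasSubst v := by
    apply MvPowerSeries.hasSubst_of_constantCoeff_zero
    intro i
    fin_cases i
    · exact PowerSeries.constantCoeff_X
    · change PowerSeries.constantCoeff (PowerSeries.C X * PowerSeries.X : PowerSeries k[X]) = 0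
      simp
  let φ : MvPowerSeries (Fin 2) k →ₐ[k] MvPowerSeries Unit k[X] := MvPowerSeries.substAlgHom hv
  refine ⟨φ.toRingHom, ?_, ?_, ?_⟩
  · have hcoeff : ∀ (f : MvPowerSeries (Fin 2) k) (e : Fin 2 →₀ ℕ),
        (PowerSeries.coeff (e 0 + e 1) (φ f : PowerSeries k[X])).coeff (e 1) =
          MvPowerSeries.coeff e f := by
      intro f e
      have h1 := MvPowerSeries.coeff_subst hv f (Finsupp.single () (e 0 + e 1))
      have hfin := MvPowerSeries.coeff_subst_finite hv f (Finsupp.single () (e 0 + e 1))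
      have h2 : PowerSeries.coeff (e 0 + e 1) (φ f : PowerSeries k[X]) =
          MvPowerSeries.coeff (Finsupp.single () (e 0 + e 1)) (MvPowerSeries.subst v f) := by
        rw [← MvPowerSeries.coe_substAlgHom hv]
        rfl
      rw [h1] at h2
      have hmon : ∀ d : Fin 2 →₀ ℕ, ∀ n : ℕ,
          MvPowerSeries.coeff (Finsupp.single () n) (d.prod fun s e => (v s) ^ e) =
          if n = d 0 + d 1 then (X : k[X]) ^ (d 1) else 0 := by
        intro d n
        have : (d.prod fun s e => (v s) ^ e) =
            (PowerSeries.C (X ^ (d 1)) * PowerSeries.X ^ (d 0 + d 1) : PowerSeries k[X]) := by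
          rw [Finsupp.prod_fintype _ _ (by simp), Fin.prod_univ_two]
          change (PowerSeries.X : PowerSeries k[X]) ^ d 0 *
            (PowerSeries.C X * PowerSeries.X : PowerSeries k[X]) ^ d 1 = _
          rw [map_pow]; ring
        rw [this]
        change PowerSeries.coeff n _ = _
        rw [PowerSeries.coeff_C_mul, PowerSeries.coeff_X_pow]
        split_ifs <;> simp
      rw [h2]
      rw [← Polynomial.lcoeff_apply, map_finsum _ hfin]
      rw [finsum_eq_single _ e]
      · rw [hmon]; simp
      · intro d hd
        rw [hmon]
        split_ifs with h
        · simp only [Polynomial.lcoeff_apply, Polynomial.coeff_smul, Polynomial.coeff_X_pow]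
          rw [if_neg, smul_zero]
          intro h'
          apply hd
          ext i
          fin_cases i
          · change d 0 = e 0; omega
          · exact h'.symm
        · simp
    rw [injective_iff_map_eq_zero]
    intro f hf
    ext e
    rw [← hcoeff f e]
    have : φ f = 0 := hf
    rw [this]
    simp
  · exact MvPowerSeries.substAlgHom_X hv 0
  · exact MvPowerSeries.substAlgHom_X hv 1

lemma bqG_K {p : ℕ} [Fact p.Prime] (hp : p % 4 = 3)
    (K : Type) [Field K] [Algebra (MvPowerSeries (Fin 2) (ZMod p)) K]
    [IsFractionRing (MvPowerSeries (Fin 2) (ZMod p)) K]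
    (x y t : K)
    (hx : x = algebraMap (MvPowerSeries (Fin 2) (ZMod p)) K (MvPowerSeries.X 0))
    (hy : y = algebraMap (MvPowerSeries (Fin 2) (ZMod p)) K (MvPowerSeries.X 1))
    (ht : y = t * x) (a b : Fin 4 → K) (d : K) (h : bqG t a b = x ^ 2 * d ^ 4) :
    (∀ i, a i = 0 ∧ b i = 0) ∧ d = 0 := by
  obtain ⟨φ, hφ, h0, h1⟩ := bq_embed_exists (ZMod p)
  let F := FractionRing (PowerSeries (ZMod p)[X])
  have hinj : Function.Injective ((algebraMap (PowerSeries (ZMod p)[X]) F).comp φ) :=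
    (IsFractionRing.injective (PowerSeries (ZMod p)[X]) F).comp hφ
  let ψ : K →+* F := IsFractionRing.lift hinj
  have hψ : ∀ r, ψ (algebraMap _ K r) = algebraMap (PowerSeries (ZMod p)[X]) F (φ r) :=
    fun r => IsFractionRing.lift_algebraMap hinj r
  have hψx : ψ x = algebraMap (PowerSeries (ZMod p)[X]) F PowerSeries.X := by rw [hx, hψ, h0]
  have hne : algebraMap (PowerSeries (ZMod p)[X]) F PowerSeries.X ≠ 0 := by
    rw [Ne, map_eq_zero_iff _ (IsFractionRing.injective (PowerSeries (ZMod p)[X]) F)]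
    exact PowerSeries.X_ne_zero
  have hψt : ψ t = algebraMap (PowerSeries (ZMod p)[X]) F (PowerSeries.C X) := by
    apply mul_right_cancel₀ hne
    rw [← hψx, ← map_mul, ← ht, hy, hψ, h1, map_mul, hψx]
  have h2 := congrArg ψ h
  rw [bqG_map, hψt, map_mul, map_pow, map_pow, hψx] at h2
  obtain ⟨k1, k2⟩ := bqG_frac hp F _ _ _ h2
  simpa using And.intro k1 k2

end part2
section part3
open Quaternion TensorProduct

variable {K : Type*} [Field K] {A : Type*} [Ring A] [Algebra K A]

lemma bq_norm_id (t x : K) (q r : ℍ[K, -1, t])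
    (h1 : q * q - algebraMap K _ (1 + t) * (r * r) = algebraMap K _ x)
    (h2 : r * q = q * r) :
    bqG t ![q.re, q.imI, q.imJ, q.imK] ![r.re, r.imI, r.imJ, r.imK] = x ^ 2 := by
  have e1 := congrArg QuaternionAlgebra.re h1
  have e2 := congrArg QuaternionAlgebra.imI h1
  have e3 := congrArg QuaternionAlgebra.imJ h1
  have e4 := congrArg QuaternionAlgebra.imK h1
  have f2 := congrArg QuaternionAlgebra.imI h2
  have f3 := congrArg QuaternionAlgebra.imJ h2
  have f4 := congrArg QuaternionAlgebra.imK h2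
  simp only [QuaternionAlgebra.algebraMap_eq, QuaternionAlgebra.re_sub, QuaternionAlgebra.imI_sub,
    QuaternionAlgebra.imJ_sub, QuaternionAlgebra.imK_sub, QuaternionAlgebra.re_mul,
    QuaternionAlgebra.imI_mul, QuaternionAlgebra.imJ_mul, QuaternionAlgebra.imK_mul] at e1 e2 e3 e4 f2 f3 f4
  rw [← sub_eq_zero] at f2 f3 f4
  have id : ∀ u0 u1 u2 u3 v1 v2 v3 : K, u0 = x → u1 = 0 → u2 = 0 → u3 = 0 → v1 = 0 → v2 = 0 →
      v3 = 0 → u0 ^ 2 + u1 ^ 2 - t * (u2 ^ 2 + u3 ^ 2) + (1 + t) * (v1 ^ 2 - t * (v2 ^ 2 + v3 ^ 2))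
        = x ^ 2 := by
    intro u0 u1 u2 u3 v1 v2 v3 h0 h1 h2 h3 h4 h5 h6
    rw [h0, h1, h2, h3, h4, h5, h6]
    ring
  rw [← id _ _ _ _ _ _ _ e1 e2 e3 e4 f2 f3 f4]
  simp only [bqG, Matrix.cons_val]
  ring

/-- The element `q + r I`. -/
def bqM {t : K} (ι : ℍ[K, -1, t] →ₐ[K] A) (I : A) (q r : ℍ[K, -1, t]) : A := ι q + ι r * I

lemma bqM_mul {t : K} (ι : ℍ[K, -1, t] →ₐ[K] A) (I : A) (c : K)
    (hI : I * I = algebraMap K A c) (hc : ∀ q, I * ι q = ι q * I) (q r q' r' : ℍ[K, -1, t]) :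
    bqM ι I q r * bqM ι I q' r' =
      bqM ι I (q * q' + algebraMap K _ c * (r * r')) (q * r' + r * q') := by
  simp only [bqM, map_add, map_mul, AlgHom.commutes]
  have : ι r * I * (ι r' * I) = algebraMap K A c * (ι r * ι r') := by
    rw [mul_assoc, ← mul_assoc I, hc, mul_assoc (ι r'), hI, Algebra.commutes c,
      mul_assoc]
  have h2 : ι r * I * ι q' = ι r * ι q' * I := by rw [mul_assoc, hc, mul_assoc]
  rw [add_mul, mul_add, mul_add, this, h2, add_mul]
  noncomm_ring

lemma bqM_inv {t : K} (ι : ℍ[K, -1, t] →ₐ[K] A) (I : A)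
    (hI : I * I = algebraMap K A (1 + t)) (hc : ∀ q, I * ι q = ι q * I) (q r : ℍ[K, -1, t])
    (hG : bqG t ![q.re, q.imI, q.imJ, q.imK] ![r.re, r.imI, r.imJ, r.imK] ≠ 0) :
    ∃ q' r', bqM ι I q r * bqM ι I q' r' = 1 := by
  set g := bqG t ![q.re, q.imI, q.imJ, q.imK] ![r.re, r.imI, r.imJ, r.imK] with hg
  let P : K := q.re ^ 2 + q.imI ^ 2 - t * (q.imJ ^ 2 + q.imK ^ 2)
    + (1 + t) * (r.re ^ 2 + r.imI ^ 2 - t * (r.imJ ^ 2 + r.imK ^ 2))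
  let Q : K := 2 * (q.re * r.re + q.imI * r.imI - t * (q.imJ * r.imJ + q.imK * r.imK))
  have hgPQ : P * P - (1 + t) * (Q * Q) = g := by
    simp only [hg, bqG, P, Q, Matrix.cons_val]; ring
  have h1 : bqM ι I q r * bqM ι I (star q) (star r) = bqM ι I (algebraMap K _ P) (algebraMap K _ Q) := by
    rw [bqM_mul ι I _ hI hc]
    congr 1
    · ext <;> simp [P, QuaternionAlgebra.algebraMap_eq] <;> ring
    · ext <;> simp [Q, QuaternionAlgebra.algebraMap_eq] <;> ring
  have h2 : bqM ι I q r * (bqM ι I (star q) (star r) *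
      bqM ι I (algebraMap K _ (P * g⁻¹)) (algebraMap K _ (-Q * g⁻¹))) = 1 := by
    rw [← mul_assoc, h1, bqM_mul ι I _ hI hc]
    simp only [← map_mul, ← map_add]
    have e1 : P * (P * g⁻¹) + (1 + t) * (Q * (-Q * g⁻¹)) = 1 := by
      field_simp
      linear_combination hgPQ
    have e2 : P * (-Q * g⁻¹) + Q * (P * g⁻¹) = 0 := by ring
    rw [e1, e2]
    simp [bqM]
  rw [bqM_mul ι I _ hI hc (star q)] at h2
  exact ⟨_, _, h2⟩

lemma bq_division [Module.Finite K A] {t x : K} (ι : ℍ[K, -1, t] →ₐ[K] A) (I J : A)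
    (hI : I * I = algebraMap K A (1 + t)) (hc : ∀ q, I * ι q = ι q * I)
    (hJ : J * J = algebraMap K A x) (hcJ : ∀ q, J * ι q = ι q * J) (hIJ : J * I = - (I * J))
    (H : ∀ (a b : Fin 4 → K) (d : K), bqG t a b = x ^ 2 * d ^ 4 →
      (∀ i, a i = 0 ∧ b i = 0) ∧ d = 0)
    (hspan : ∀ z : A, ∃ q0 q1 q2 q3, z = bqM ι I q0 q1 + bqM ι I q2 q3 * J)
    (z : A) (hz : z ≠ 0) : IsUnit z := by
  have hart : IsArtinianRing A := IsArtinianRing.of_finite K A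
  have hded : IsDedekindFiniteMonoid A := inferInstance
  have unitM : ∀ q r, ¬ (q = 0 ∧ r = 0) → ∃ q' r', bqM ι I q r * bqM ι I q' r' = 1 := by
    intro q r h
    apply bqM_inv ι I hI hc
    intro h0
    obtain ⟨k, -⟩ := H _ _ 0 (h0.trans (by ring))
    apply h
    have k0 := k 0
    have k1 := k 1
    have k2 := k 2
    have k3 := k 3
    simp only [Matrix.cons_val] at k0 k1 k2 k3
    constructor
    · ext
      exacts [k0.1, k1.1, k2.1, k3.1]
    · ext
      exacts [k0.2, k1.2, k2.2, k3.2]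
  have key : ∀ q r, IsUnit (bqM ι I q r + J) := by
    intro q r
    have hconj : J * bqM ι I q (-r) = bqM ι I q r * J := by
      simp only [bqM, map_neg, mul_add, add_mul, hcJ, neg_mul, mul_neg]
      rw [← mul_assoc, hcJ, mul_assoc, hIJ]
      noncomm_ring
    have hprod : (bqM ι I q r + J) * (J - bqM ι I q (-r)) =
        bqM ι I (algebraMap K _ x - (q * q - algebraMap K _ (1 + t) * (r * r))) (q * r - r * q) := by
      have e : (bqM ι I q r + J) * (J - bqM ι I q (-r)) =
          J * J - bqM ι I q r * bqM ι I q (-r) + (bqM ι I q r * J - J * bqM ι I q (-r)) := by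
        noncomm_ring
      rw [e, hconj, bqM_mul ι I _ hI hc, hJ]
      simp only [bqM, map_sub, map_add, map_mul, map_neg, AlgHom.commutes]
      noncomm_ring
    obtain ⟨q', r', h⟩ := unitM (algebraMap K _ x - (q * q - algebraMap K _ (1 + t) * (r * r)))
        (q * r - r * q) (by
      rintro ⟨h1, h2⟩
      have := bq_norm_id t x q r (sub_eq_zero.mp h1).symm (sub_eq_zero.mp h2).symm
      have := (H _ _ 1 (this.trans (by ring))).2
      exact one_ne_zero this)
    rw [← hprod, mul_assoc] at h
    exact IsUnit.of_mul_eq_one _ h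
  obtain ⟨q0, q1, q2, q3, rfl⟩ := hspan z
  by_cases h : q2 = 0 ∧ q3 = 0
  · obtain ⟨rfl, rfl⟩ := h
    have e : bqM ι I 0 0 = 0 := by simp [bqM]
    rw [e, zero_mul, add_zero] at hz ⊢
    obtain ⟨q', r', h⟩ := unitM q0 q1 (by
      rintro ⟨rfl, rfl⟩
      exact hz e)
    exact IsUnit.of_mul_eq_one _ h
  · obtain ⟨q', r', h⟩ := unitM q2 q3 h
    have e : bqM ι I q0 q1 + bqM ι I q2 q3 * J =
        bqM ι I q2 q3 * (bqM ι I q' r' * bqM ι I q0 q1 + J) := by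
      rw [mul_add, ← mul_assoc, h, one_mul]
    rw [e, bqM_mul ι I _ hI hc]
    exact (IsUnit.of_mul_eq_one _ h).mul (key _ _)

end part3
section part4
open Quaternion TensorProduct

variable {K : Type*} [Field K]

lemma bq_model_division {t x : K}
    (H : ∀ (a b : Fin 4 → K) (d : K), bqG t a b = x ^ 2 * d ^ 4 →
      (∀ i, a i = 0 ∧ b i = 0) ∧ d = 0)
    (z : ℍ[K, -1, t] ⊗[K] ℍ[K, 1 + t, x]) (hz : z ≠ 0) : IsUnit z := by
  let i' : ℍ[K, 1 + t, x] := ⟨0, 1, 0, 0⟩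
  let j' : ℍ[K, 1 + t, x] := ⟨0, 0, 1, 0⟩
  have hii : i' * i' = algebraMap K _ (1 + t) := by
    ext <;> simp [i', QuaternionAlgebra.algebraMap_eq]
  have hjj : j' * j' = algebraMap K _ x := by
    ext <;> simp [j', QuaternionAlgebra.algebraMap_eq]
  have hji : j' * i' = - (i' * j') := by
    ext <;> simp [i', j']
  have hr : ∀ r : ℍ[K, 1 + t, x],
      r = r.re • 1 + r.imI • i' + r.imJ • j' + r.imK • (i' * j') := by
    intro r
    ext <;> simp [i', j']
  refine bq_division (Algebra.TensorProduct.includeLeft : _ →ₐ[K] _ ⊗[K] ℍ[K, 1 + t, x])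
    (1 ⊗ₜ i') (1 ⊗ₜ j') ?_ ?_ ?_ ?_ ?_ H ?_ z hz
  · rw [Algebra.TensorProduct.tmul_mul_tmul, hii, one_mul]
    exact (Algebra.TensorProduct.algebraMap_apply' (1 + t)).symm
  · intro q; simp
  · rw [Algebra.TensorProduct.tmul_mul_tmul, hjj, one_mul]
    exact (Algebra.TensorProduct.algebraMap_apply' x).symm
  · intro q; simp
  · rw [Algebra.TensorProduct.tmul_mul_tmul, hji, Algebra.TensorProduct.tmul_mul_tmul,
      TensorProduct.tmul_neg]
  · intro z
    induction z using TensorProduct.induction_on with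
    | zero => exact ⟨0, 0, 0, 0, by simp [bqM]⟩
    | tmul q r =>
      refine ⟨r.re • q, r.imI • q, r.imJ • q, r.imK • q, ?_⟩
      conv_lhs => rw [hr r]
      simp only [bqM, Algebra.TensorProduct.includeLeft_apply, add_mul,
        Algebra.TensorProduct.tmul_mul_tmul, one_mul, mul_one, TensorProduct.tmul_add,
        TensorProduct.tmul_smul, TensorProduct.smul_tmul', add_assoc]
    | add a b ha hb =>
      obtain ⟨q0, q1, q2, q3, rfl⟩ := ha
      obtain ⟨r0, r1, r2, r3, rfl⟩ := hb
      refine ⟨q0 + r0, q1 + r1, q2 + r2, q3 + r3, ?_⟩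
      simp only [bqM, map_add, add_mul]
      abel

lemma bq_range {A : Type*} [Ring A] [Algebra K A] {a b : K} (f : ℍ[K, a, b] →ₐ[K] A)
    (S : Subalgebra K A) (hi : f ⟨0, 1, 0, 0⟩ ∈ S) (hj : f ⟨0, 0, 1, 0⟩ ∈ S) (q : ℍ[K, a, b]) :
    f q ∈ S := by
  have hq : q = q.re • 1 + q.imI • ⟨0, 1, 0, 0⟩ + q.imJ • ⟨0, 0, 1, 0⟩
      + q.imK • (⟨0, 1, 0, 0⟩ * ⟨0, 0, 1, 0⟩) := by
    ext <;> simp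
  rw [hq]
  simp only [map_add, map_smul, map_mul, map_one]
  exact add_mem (add_mem (add_mem (S.smul_mem (one_mem _) _) (S.smul_mem hi _)) (S.smul_mem hj _))
    (S.smul_mem (mul_mem hi hj) _)

lemma bq_main_division {t x y : K} (hx : x ≠ 0) (ht : y = t * x)
    (H : ∀ (a b : Fin 4 → K) (d : K), bqG t a b = x ^ 2 * d ^ 4 →
      (∀ i, a i = 0 ∧ b i = 0) ∧ d = 0)
    (z : ℍ[K, -1, y] ⊗[K] ℍ[K, y + x, x]) (hz : z ≠ 0) : IsUnit z := by
  let i : ℍ[K, -1, y] := ⟨0, 1, 0, 0⟩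
  let j : ℍ[K, -1, y] := ⟨0, 0, 1, 0⟩
  let I : ℍ[K, y + x, x] := ⟨0, 1, 0, 0⟩
  let J : ℍ[K, y + x, x] := ⟨0, 0, 1, 0⟩
  have hii : i * i = (-1 : K) • 1 := by ext <;> simp [i]
  have hjj : j * j = y • 1 := by ext <;> simp [j]
  have hji : j * i = - (i * j) := by ext <;> simp [i, j]
  have hII : I * I = (y + x) • 1 := by ext <;> simp [I]
  have hJJ : J * J = x • 1 := by ext <;> simp [J]
  have hJI : J * I = - (I * J) := by ext <;> simp [I, J]
  have hIJIJ : (I * J) * (I * J) = (-(x * (y + x))) • 1 := by ext <;> simp [I, J]; ring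
  have hIJJ : (I * J) * J = x • I := by rw [mul_assoc, hJJ]; simp
  have hJIJ : J * (I * J) = - (x • I) := by rw [← mul_assoc, hJI, neg_mul, hIJJ]
  let B1 : QuaternionAlgebra.Basis (ℍ[K, -1, y] ⊗[K] ℍ[K, y + x, x]) (-1 : K) 0 t :=
    { i := i ⊗ₜ 1
      j := x⁻¹ • (j ⊗ₜ J)
      k := x⁻¹ • ((i * j) ⊗ₜ J)
      i_mul_i := by
        rw [Algebra.TensorProduct.tmul_mul_tmul, hii, one_mul, ← TensorProduct.smul_tmul', zero_smul,
          add_zero, Algebra.TensorProduct.one_def]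
      j_mul_j := by
        rw [smul_mul_smul_comm, Algebra.TensorProduct.tmul_mul_tmul, hjj, hJJ,
          ← TensorProduct.smul_tmul', TensorProduct.tmul_smul, smul_smul, smul_smul,
          Algebra.TensorProduct.one_def]
        congr 1
        rw [ht]; field_simp
      i_mul_j := by
        rw [mul_smul_comm, Algebra.TensorProduct.tmul_mul_tmul, one_mul]
      j_mul_i := by
        rw [smul_mul_assoc, Algebra.TensorProduct.tmul_mul_tmul, mul_one, hji, zero_smul, zero_sub,
          TensorProduct.neg_tmul, smul_neg] }
  let B2 : QuaternionAlgebra.Basis (ℍ[K, -1, y] ⊗[K] ℍ[K, y + x, x]) (1 + t : K) 0 x :=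
    { i := x⁻¹ • (i ⊗ₜ (I * J))
      j := 1 ⊗ₜ J
      k := i ⊗ₜ I
      i_mul_i := by
        rw [smul_mul_smul_comm, Algebra.TensorProduct.tmul_mul_tmul, hii, hIJIJ,
          ← TensorProduct.smul_tmul', TensorProduct.tmul_smul, smul_smul, smul_smul, zero_smul,
          add_zero, Algebra.TensorProduct.one_def]
        congr 1
        rw [ht]; field_simp; ring
      j_mul_j := by
        rw [Algebra.TensorProduct.tmul_mul_tmul, hJJ, one_mul, TensorProduct.tmul_smul,
          Algebra.TensorProduct.one_def]
      i_mul_j := by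
        rw [smul_mul_assoc, Algebra.TensorProduct.tmul_mul_tmul, hIJJ, mul_one,
          TensorProduct.tmul_smul, smul_smul, inv_mul_cancel₀ hx, one_smul]
      j_mul_i := by
        rw [mul_smul_comm, Algebra.TensorProduct.tmul_mul_tmul, hJIJ, one_mul,
          TensorProduct.tmul_neg, TensorProduct.tmul_smul, smul_neg, smul_smul,
          inv_mul_cancel₀ hx, one_smul, zero_smul, zero_sub] }
  have hcomm : ∀ q r, Commute (B1.liftHom q) (B2.liftHom r) := by
    have c1 : Commute B1.i B2.i := by
      change _ * _ = _ * _
      simp only [B1, B2, smul_mul_assoc, mul_smul_comm, Algebra.TensorProduct.tmul_mul_tmul,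
        one_mul, mul_one]
    have c2 : Commute B1.i B2.j := by
      change _ * _ = _ * _
      simp only [B1, B2, Algebra.TensorProduct.tmul_mul_tmul, one_mul, mul_one]
    have c3 : Commute B1.j B2.i := by
      change _ * _ = _ * _
      simp only [B1, B2, smul_mul_assoc, mul_smul_comm, Algebra.TensorProduct.tmul_mul_tmul,
        hji, hJIJ, hIJJ, TensorProduct.neg_tmul, TensorProduct.tmul_neg, neg_neg]
    have c4 : Commute B1.j B2.j := by
      change _ * _ = _ * _
      simp only [B1, B2, smul_mul_assoc, mul_smul_comm, Algebra.TensorProduct.tmul_mul_tmul,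
        one_mul, mul_one]
    intro q r
    have hB1i : B1.liftHom ⟨0, 1, 0, 0⟩ = B1.i := by
      simp [QuaternionAlgebra.Basis.lift]
    have hB1j : B1.liftHom ⟨0, 0, 1, 0⟩ = B1.j := by
      simp [QuaternionAlgebra.Basis.lift]
    have hB2i : B2.liftHom ⟨0, 1, 0, 0⟩ = B2.i := by
      simp [QuaternionAlgebra.Basis.lift]
    have hB2j : B2.liftHom ⟨0, 0, 1, 0⟩ = B2.j := by
      simp [QuaternionAlgebra.Basis.lift]
    have s1 : ∀ q, Commute (B1.liftHom q) B2.i := fun q => by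
      have := bq_range B1.liftHom (Subalgebra.centralizer K {B2.i})
        (by rw [hB1i, Subalgebra.mem_centralizer_iff]; rintro _ rfl; exact c1.symm)
        (by rw [hB1j, Subalgebra.mem_centralizer_iff]; rintro _ rfl; exact c3.symm) q
      rw [Subalgebra.mem_centralizer_iff] at this
      exact (this _ rfl).symm
    have s2 : ∀ q, Commute (B1.liftHom q) B2.j := fun q => by
      have := bq_range B1.liftHom (Subalgebra.centralizer K {B2.j})
        (by rw [hB1i, Subalgebra.mem_centralizer_iff]; rintro _ rfl; exact c2.symm)
        (by rw [hB1j, Subalgebra.mem_centralizer_iff]; rintro _ rfl; exact c4.symm) q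
      rw [Subalgebra.mem_centralizer_iff] at this
      exact (this _ rfl).symm
    have := bq_range B2.liftHom (Subalgebra.centralizer K {B1.liftHom q})
        (by rw [hB2i, Subalgebra.mem_centralizer_iff]; rintro _ rfl; exact s1 q)
        (by rw [hB2j, Subalgebra.mem_centralizer_iff]; rintro _ rfl; exact s2 q) r
    rw [Subalgebra.mem_centralizer_iff] at this
    exact this _ rfl
  let f : ℍ[K, -1, t] ⊗[K] ℍ[K, 1 + t, x] →ₐ[K] ℍ[K, -1, y] ⊗[K] ℍ[K, y + x, x] :=
    Algebra.TensorProduct.lift B1.liftHom B2.liftHom hcomm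
  have m1 : i ⊗ₜ 1 ∈ f.range := ⟨⟨0, 1, 0, 0⟩ ⊗ₜ 1, by
    simp [f, QuaternionAlgebra.Basis.lift, B1]⟩
  have m2 : 1 ⊗ₜ J ∈ f.range := ⟨1 ⊗ₜ ⟨0, 0, 1, 0⟩, by
    simp [f, QuaternionAlgebra.Basis.lift, B2]⟩
  have m3 : j ⊗ₜ 1 ∈ f.range := by
    have : x⁻¹ • (j ⊗ₜ J) ∈ f.range := ⟨⟨0, 0, 1, 0⟩ ⊗ₜ 1, by
      simp [f, QuaternionAlgebra.Basis.lift, B1, smul_mul_assoc]⟩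
    have := mul_mem this m2
    rwa [smul_mul_assoc, Algebra.TensorProduct.tmul_mul_tmul, mul_one, hJJ,
      TensorProduct.tmul_smul, smul_smul, inv_mul_cancel₀ hx, one_smul] at this
  have m4 : 1 ⊗ₜ I ∈ f.range := by
    have : i ⊗ₜ I ∈ f.range := ⟨1 ⊗ₜ ⟨0, 0, 0, 1⟩, by
      simp [f, QuaternionAlgebra.Basis.lift, B2]⟩
    have := neg_mem (mul_mem m1 this)
    rwa [Algebra.TensorProduct.tmul_mul_tmul, hii, one_mul, ← TensorProduct.smul_tmul',
      neg_smul, one_smul, neg_neg] at this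
  have hsurj : ∀ z, z ∈ f.range := by
    intro z
    induction z using TensorProduct.induction_on with
    | zero => exact zero_mem _
    | add a b ha hb => exact add_mem ha hb
    | tmul q r =>
      have h1 := bq_range (Algebra.TensorProduct.includeLeft :
        ℍ[K, -1, y] →ₐ[K] ℍ[K, -1, y] ⊗[K] ℍ[K, y + x, x]) f.range m1 m3 q
      have h2 := bq_range (Algebra.TensorProduct.includeRight :
        ℍ[K, y + x, x] →ₐ[K] ℍ[K, -1, y] ⊗[K] ℍ[K, y + x, x]) f.range m4 m2 r
      have := mul_mem h1 h2
      simpa using this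
  obtain ⟨w, rfl⟩ := hsurj z
  have hw : w ≠ 0 := by
    rintro rfl
    exact hz (map_zero _)
  exact (bq_model_division H w hw).map f

end part4
section part5
open Quaternion TensorProduct

variable {K : Type*} [Field K]

lemma bq_azumaya (h2 : (2 : K) ≠ 0) {a b : K} (ha : a ≠ 0) (hb : b ≠ 0) :
    Function.Bijective (AlgHom.mulLeftRight K ℍ[K, a, b]) := by
  let M := AlgHom.mulLeftRight K ℍ[K, a, b]
  have hM : ∀ u v q : ℍ[K, a, b], M (u ⊗ₜ MulOpposite.op v) q = u * q * v := by
    intro u v q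
    simp [M]
  have h4 : (4 : K) ≠ 0 := by
    have : (4 : K) = 2 * 2 := by norm_num
    rw [this]; exact mul_ne_zero h2 h2
  let i : ℍ[K, a, b] := ⟨0, 1, 0, 0⟩
  let j : ℍ[K, a, b] := ⟨0, 0, 1, 0⟩
  let k : ℍ[K, a, b] := ⟨0, 0, 0, 1⟩
  let π : ℍ[K, a, b] ⊗[K] ℍ[K, a, b]ᵐᵒᵖ :=
    (4 : K)⁻¹ • (1 ⊗ₜ MulOpposite.op 1 + i ⊗ₜ MulOpposite.op (a⁻¹ • i)
      + j ⊗ₜ MulOpposite.op (b⁻¹ • j) + k ⊗ₜ MulOpposite.op (-(a⁻¹ * b⁻¹) • k))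
  have hπ : ∀ q, M π q = q.re • 1 := by
    intro q
    simp only [π, map_smul, map_add, LinearMap.smul_apply, LinearMap.add_apply, hM]
    ext <;> simp [i, j, k] <;> field_simp <;> ring
  have hsurj : Function.Surjective M := by
    intro f
    refine ⟨f 1 ⊗ₜ 1 * π + f i ⊗ₜ 1 * π * ((a⁻¹ • i) ⊗ₜ 1) + f j ⊗ₜ 1 * π * ((b⁻¹ • j) ⊗ₜ 1)
      + f k ⊗ₜ 1 * π * ((-(a⁻¹ * b⁻¹) • k) ⊗ₜ 1), ?_⟩
    apply LinearMap.ext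
    intro q
    have hM1 : ∀ u q : ℍ[K, a, b], M (u ⊗ₜ 1) q = u * q := by
      intro u q
      have := hM u 1 q
      simpa using this
    have hq : q = q.re • 1 + q.imI • i + q.imJ • j + q.imK • k := by
      ext <;> simp [i, j, k]
    have e1 : ((a⁻¹ • i) * q).re = q.imI := by simp [i]; field_simp
    have e2 : ((b⁻¹ • j) * q).re = q.imJ := by simp [j]; field_simp
    have e3 : ((-(a⁻¹ * b⁻¹) • k) * q).re = q.imK := by simp [k]; field_simp
    simp only [map_add, map_mul, LinearMap.add_apply, Module.End.mul_apply, hM1, hπ, e1, e2, e3]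
    conv_rhs => rw [hq]
    simp only [map_add, map_smul, mul_smul_comm, mul_one]
  refine ⟨?_, hsurj⟩
  have hfr : Module.finrank K (ℍ[K, a, b] ⊗[K] ℍ[K, a, b]ᵐᵒᵖ) =
      Module.finrank K (Module.End K ℍ[K, a, b]) := by
    rw [Module.finrank_tensorProduct, Module.finrank_linearMap,
      ← (MulOpposite.opLinearEquiv K (M := ℍ[K, a, b])).finrank_eq]
  exact (LinearMap.injective_iff_surjective_of_finrank_eq_finrank
    (f := M.toLinearMap) hfr).mpr hsurj

lemma bq_sq_split (h2 : (2 : K) ≠ 0) {a b : K} (ha : a ≠ 0) (hb : b ≠ 0) :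
    Nonempty (ℍ[K, a, b] ⊗[K] ℍ[K, a, b] ≃ₐ[K] Matrix (Fin 4) (Fin 4) K) := by
  refine ⟨(Algebra.TensorProduct.congr AlgEquiv.refl QuaternionAlgebra.starAe).trans
    ((AlgEquiv.ofBijective _ (bq_azumaya h2 ha hb)).trans
      (algEquivMatrix (QuaternionAlgebra.basisOneIJK a 0 b)))⟩

lemma bq_period (h2 : (2 : K) ≠ 0) {a b c d : K} (ha : a ≠ 0) (hb : b ≠ 0) (hc : c ≠ 0)
    (hd : d ≠ 0) :
    Nonempty ((ℍ[K, a, b] ⊗[K] ℍ[K, c, d]) ⊗[K] (ℍ[K, a, b] ⊗[K] ℍ[K, c, d])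
      ≃ₐ[K] Matrix (Fin 16) (Fin 16) K) := by
  obtain ⟨e1⟩ := bq_sq_split h2 ha hb
  obtain ⟨e2⟩ := bq_sq_split h2 hc hd
  exact ⟨(Algebra.TensorProduct.tensorTensorTensorComm K K K K _ _ _ _).trans
    ((Algebra.TensorProduct.congr e1 e2).trans
      ((Matrix.kroneckerAlgEquiv (Fin 4) (Fin 4) K).trans
        (Matrix.reindexAlgEquiv K K finProdFinEquiv)))⟩

end part5

open Quaternion TensorProduct

theorem biquaternion_division_over_iterated_laurent
    (p : ℕ) [Fact p.Prime] (hp : p % 4 = 3)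
    (K : Type) [Field K] [Algebra (MvPowerSeries (Fin 2) (ZMod p)) K]
    [IsFractionRing (MvPowerSeries (Fin 2) (ZMod p)) K]
    (x y : K)
    (hx : x = algebraMap (MvPowerSeries (Fin 2) (ZMod p)) K (MvPowerSeries.X 0))
    (hy : y = algebraMap (MvPowerSeries (Fin 2) (ZMod p)) K (MvPowerSeries.X 1)) :
    Nontrivial (ℍ[K, -1, y] ⊗[K] ℍ[K, y + x, x]) ∧
    (∀ z : ℍ[K, -1, y] ⊗[K] ℍ[K, y + x, x], z ≠ 0 → IsUnit z) ∧
    Module.finrank K (ℍ[K, -1, y] ⊗[K] ℍ[K, y + x, x]) = 16 ∧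
    (∃ n : ℕ, 0 < n ∧ Nonempty
      ((ℍ[K, -1, y] ⊗[K] ℍ[K, y + x, x]) ⊗[K] (ℍ[K, -1, y] ⊗[K] ℍ[K, y + x, x])
        ≃ₐ[K] Matrix (Fin n) (Fin n) K)) := by
  have inj := IsFractionRing.injective (MvPowerSeries (Fin 2) (ZMod p)) K
  have hco : ∀ (u v : MvPowerSeries (Fin 2) (ZMod p)) (e : Fin 2 →₀ ℕ),
      MvPowerSeries.coeff e u ≠ MvPowerSeries.coeff e v →
      algebraMap (MvPowerSeries (Fin 2) (ZMod p)) K u ≠ algebraMap _ K v := by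
    intro u v e h h'
    exact h (by rw [inj h'])
  have hx0 : x ≠ 0 := by
    rw [hx, ← map_zero (algebraMap (MvPowerSeries (Fin 2) (ZMod p)) K)]
    apply hco _ _ (Finsupp.single 0 1)
    simp [MvPowerSeries.coeff_X]
  have hy0 : y ≠ 0 := by
    rw [hy, ← map_zero (algebraMap (MvPowerSeries (Fin 2) (ZMod p)) K)]
    apply hco _ _ (Finsupp.single 1 1)
    simp [MvPowerSeries.coeff_X]
  have hyx : y + x ≠ 0 := by
    rw [hx, hy, ← map_add, ← map_zero (algebraMap (MvPowerSeries (Fin 2) (ZMod p)) K)]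
    apply hco _ _ (Finsupp.single 1 1)
    simp [MvPowerSeries.coeff_X, Finsupp.single_left_inj]
  have h2 : (2 : K) ≠ 0 := by
    let g : ZMod p →+* K :=
      (algebraMap (MvPowerSeries (Fin 2) (ZMod p)) K).comp MvPowerSeries.C
    intro h
    apply bq_two hp
    apply g.injective
    rw [map_zero, ← h]
    exact map_ofNat g 2
  have ht : y = (y / x) * x := by field_simp
  have hfr : Module.finrank K (ℍ[K, -1, y] ⊗[K] ℍ[K, y + x, x]) = 16 := by
    rw [Module.finrank_tensorProduct, QuaternionAlgebra.finrank_eq_four,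
      QuaternionAlgebra.finrank_eq_four]
  refine ⟨?_, ?_, hfr, 16, by norm_num, ?_⟩
  · exact Module.nontrivial_of_finrank_pos (R := K) (by rw [hfr]; norm_num)
  · exact bq_main_division hx0 ht (fun a b d h => bqG_K hp K x y (y / x) hx hy ht a b d h)
  · exact bq_period h2 (neg_ne_zero.mpr one_ne_zero) hy0 hyx hx0
end
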